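/- Let u be a vanishing viscosity solution on Ω of the intrinsic minimal surface equation. Then for every p > 1 and every open set Ω₁ compactly contained in Ω, the function Xu := σ₁¹(·,u)·∂ₓ₁u + σ₁²(·,u)·∂ₓ₂u (defined a.e.) belongs to the Euclidean Sobolev space W^{1,p}(Ω₁); in particular its Euclidean distributional gradient lies in Lᵖ(Ω₁). -/

import Mathlib

open MeasureTheory Real Filter Topology

noncomputable section

/-- Partial derivative ∂ₓ₁ on ℝ². -/
def pd1 (f : ℝ × ℝ → ℝ) (p : ℝ × ℝ) : ℝ := fderiv ℝ f p (1, 0)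

/-- Partial derivative ∂ₓ₂ on ℝ². -/
def pd2 (f : ℝ × ℝ → ℝ) (p : ℝ × ℝ) : ℝ := fderiv ℝ f p (0, 1)

/-- Partial derivative ∂ₓ₃ on ℝ³ = ℝ × ℝ × ℝ. -/
def pd3 (g : ℝ × ℝ × ℝ → ℝ) (q : ℝ × ℝ × ℝ) : ℝ := fderiv ℝ g q (0, 0, 1)

/-- Vector field a·∂ₓ₁ + b·∂ₓ₂ with coefficients evaluated along the graph of u. -/
def VF (a b : ℝ × ℝ × ℝ → ℝ) (u : ℝ × ℝ → ℝ) (f : ℝ × ℝ → ℝ) (p : ℝ × ℝ) : ℝ :=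
  a (p.1, p.2, u p) * pd1 f p + b (p.1, p.2, u p) * pd2 f p

/-- The nonlinear vector field X₁ = X_{1,u}. -/
def X1 (s11 s12 : ℝ × ℝ × ℝ → ℝ) (u : ℝ × ℝ → ℝ) : (ℝ × ℝ → ℝ) → ℝ × ℝ → ℝ :=
  VF s11 s12 u

/-- The transverse vector field Y = X₂/ε (coefficients σ₂ʲ = ∂ₓ₃σ₁ʲ). -/
def Yf (s11 s12 : ℝ × ℝ × ℝ → ℝ) (u : ℝ × ℝ → ℝ) : (ℝ × ℝ → ℝ) → ℝ × ℝ → ℝ :=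
  VF (pd3 s11) (pd3 s12) u

/-- The scaled vector field X₂ = ε·Y. -/
def X2 (s11 s12 : ℝ × ℝ × ℝ → ℝ) (ε : ℝ) (u : ℝ × ℝ → ℝ) (f : ℝ × ℝ → ℝ) (p : ℝ × ℝ) : ℝ :=
  ε * Yf s11 s12 u f p

/-- The pair (X₁, X₂) of vector fields. -/
def XX (s11 s12 : ℝ × ℝ × ℝ → ℝ) (ε : ℝ) (u : ℝ × ℝ → ℝ) :
    Fin 2 → (ℝ × ℝ → ℝ) → ℝ × ℝ → ℝ :=
  ![X1 s11 s12 u, X2 s11 s12 ε u]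

/-- |∇ε f| = |(X₁f, X₂f)|. -/
def gradN (s11 s12 : ℝ × ℝ × ℝ → ℝ) (ε : ℝ) (u f : ℝ × ℝ → ℝ) (p : ℝ × ℝ) : ℝ :=
  Real.sqrt ((X1 s11 s12 u f p) ^ 2 + (X2 s11 s12 ε u f p) ^ 2)

/-- The weight √(1+|∇εu|²). -/
def Wt (s11 s12 : ℝ × ℝ × ℝ → ℝ) (ε : ℝ) (u : ℝ × ℝ → ℝ) (p : ℝ × ℝ) : ℝ :=
  Real.sqrt (1 + (gradN s11 s12 ε u u p) ^ 2)

/-- The regularized minimal surface operator L_{ε,u}u = Σᵢ Xᵢ(Xᵢu/√(1+|∇εu|²)). -/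
def Lop (s11 s12 : ℝ × ℝ × ℝ → ℝ) (ε : ℝ) (u : ℝ × ℝ → ℝ) (p : ℝ × ℝ) : ℝ :=
  X1 s11 s12 u (fun q => X1 s11 s12 u u q / Wt s11 s12 ε u q) p +
  X2 s11 s12 ε u (fun q => X2 s11 s12 ε u u q / Wt s11 s12 ε u q) p

/-- The coefficients a_{ij}(∇εu) = δ_{ij} − (Xᵢu)(Xⱼu)/(1+|∇εu|²). -/
def aC (s11 s12 : ℝ × ℝ × ℝ → ℝ) (ε : ℝ) (u : ℝ × ℝ → ℝ) (i j : Fin 2) (p : ℝ × ℝ) : ℝ :=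
  (if i = j then 1 else 0) -
    XX s11 s12 ε u i u p * XX s11 s12 ε u j u p / (1 + (gradN s11 s12 ε u u p) ^ 2)

/-- The coefficients 𝒜_{ij} = a_{ij}(∇εu)/√(1+|∇εu|²). -/
def AC (s11 s12 : ℝ × ℝ × ℝ → ℝ) (ε : ℝ) (u : ℝ × ℝ → ℝ) (i j : Fin 2) (p : ℝ × ℝ) : ℝ :=
  aC s11 s12 ε u i j p / Wt s11 s12 ε u p

/-- The linearized divergence–form operator M_{ε,u}z = Σ_{i,j} Xᵢ(𝒜_{ij}·Xⱼz). -/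
def Mop (s11 s12 : ℝ × ℝ × ℝ → ℝ) (ε : ℝ) (u z : ℝ × ℝ → ℝ) (p : ℝ × ℝ) : ℝ :=
  ∑ i : Fin 2, ∑ j : Fin 2,
    XX s11 s12 ε u i (fun q => AC s11 s12 ε u i j q * XX s11 s12 ε u j z q) p

/-- Iterated derivatives X_{i₁}⋯X_{i_k} z. -/
def iterX (s11 s12 : ℝ × ℝ × ℝ → ℝ) (ε : ℝ) (u : ℝ × ℝ → ℝ) :
    (k : ℕ) → (Fin k → Fin 2) → (ℝ × ℝ → ℝ) → ℝ × ℝ → ℝ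
  | 0, _, z => z
  | k + 1, I, z => XX s11 s12 ε u (I 0) (iterX s11 s12 ε u k (fun j => I j.succ) z)

/-- |∇εᵏ z| : Euclidean norm of the vector of all k-fold iterated derivatives. -/
def gradkN (s11 s12 : ℝ × ℝ × ℝ → ℝ) (ε : ℝ) (u : ℝ × ℝ → ℝ) (k : ℕ) (z : ℝ × ℝ → ℝ)
    (p : ℝ × ℝ) : ℝ :=
  Real.sqrt (∑ I : Fin k → Fin 2, (iterX s11 s12 ε u k I z p) ^ 2)

/-- Lᵖ norm over K. -/
def LpN (q : ℝ) (f : ℝ × ℝ → ℝ) (K : Set (ℝ × ℝ)) : ℝ :=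
  (∫ p in K, |f p| ^ q) ^ (1 / q)

/-- Sobolev norm ‖z‖_{Wε^{m,q}(K)} = Σ_{k=0}^m ‖|∇εᵏz|‖_{Lᵠ(K)}. -/
def WN (s11 s12 : ℝ × ℝ × ℝ → ℝ) (ε : ℝ) (u : ℝ × ℝ → ℝ) (m : ℕ) (q : ℝ)
    (z : ℝ × ℝ → ℝ) (K : Set (ℝ × ℝ)) : ℝ :=
  ∑ k ∈ Finset.range (m + 1), LpN q (gradkN s11 s12 ε u k z) K

/-- m₁ = ∂ₓ₁[σ₁¹(·,u)] + ∂ₓ₂[σ₁²(·,u)]. -/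
def m1 (s11 s12 : ℝ × ℝ × ℝ → ℝ) (u : ℝ × ℝ → ℝ) (p : ℝ × ℝ) : ℝ :=
  pd1 (fun q => s11 (q.1, q.2, u q)) p + pd2 (fun q => s12 (q.1, q.2, u q)) p

/-- Euclidean gradient length |∇_E f|. -/
def egN (f : ℝ × ℝ → ℝ) (p : ℝ × ℝ) : ℝ :=
  Real.sqrt ((pd1 f p) ^ 2 + (pd2 f p) ^ 2)

/-- A cutoff function in Ω: smooth, compactly supported in Ω, 0 ≤ φ ≤ 1. -/
def IsCutoff (Ω : Set (ℝ × ℝ)) (φ : ℝ × ℝ → ℝ) : Prop :=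
  ContDiff ℝ (⊤ : ℕ∞) φ ∧ HasCompactSupport φ ∧ tsupport φ ⊆ Ω ∧ ∀ p, 0 ≤ φ p ∧ φ p ≤ 1

/-- A test function φ ∈ C∞_c(Ω). -/
def IsTest (Ω : Set (ℝ × ℝ)) (φ : ℝ × ℝ → ℝ) : Prop :=
  ContDiff ℝ (⊤ : ℕ∞) φ ∧ HasCompactSupport φ ∧ tsupport φ ⊆ Ω

/-- The Lipschitz bound ‖X₁u‖_{L∞(Ω)} + ‖Yu‖_{L∞(Ω)} ≤ M. -/
def LipBound (s11 s12 : ℝ × ℝ × ℝ → ℝ) (Ω : Set (ℝ × ℝ)) (u : ℝ × ℝ → ℝ) (M : ℝ) : Prop :=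
  ∀ p ∈ Ω, |X1 s11 s12 u u p| + |Yf s11 s12 u u p| ≤ M

/-- Rank condition |σ₁¹·∂ₓ₃σ₁² − σ₁²·∂ₓ₃σ₁¹| > 0. -/
def RankCond (s11 s12 : ℝ × ℝ × ℝ → ℝ) : Prop :=
  ∀ q : ℝ × ℝ × ℝ, 0 < |s11 q * pd3 s12 q - s12 q * pd3 s11 q|

/-- Vanishing viscosity solution of the intrinsic minimal surface equation. -/
def IsVVSol (s11 s12 : ℝ × ℝ × ℝ → ℝ) (Ω : Set (ℝ × ℝ)) (u : ℝ × ℝ → ℝ) : Prop :=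
  ∃ (εs : ℕ → ℝ) (us : ℕ → ℝ × ℝ → ℝ) (l : NNReal),
    (∀ n, 0 < εs n ∧ εs n ≤ 1) ∧ Tendsto εs atTop (𝓝 0) ∧
    (∀ n, ContDiff ℝ (⊤ : ℕ∞) (us n)) ∧
    (∀ n, ∀ p ∈ Ω, Lop s11 s12 (εs n) (us n) p = 0) ∧
    (∀ n, LipschitzOnWith l (us n) Ω) ∧ (∀ n, ∀ p ∈ Ω, |us n p| ≤ l) ∧
    (∀ K ⊆ Ω, IsCompact K → TendstoUniformlyOn us u atTop K)

/-- The antisymmetric commutator coefficients ω^l_{j,k} with ω^l_{1,2} = ω^l. -/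
def wAnti (ω : Fin 2 → ℝ × ℝ → ℝ) (l j k : Fin 2) (p : ℝ × ℝ) : ℝ :=
  if j = k then 0 else if j = 0 then ω l p else -(ω l p)

/-- Euclidean Hölder class C^{1,α} on Ω. -/
def EuclC1Alpha (Ω : Set (ℝ × ℝ)) (α : ℝ) (h : ℝ × ℝ → ℝ) : Prop :=
  Differentiable ℝ h ∧
    ∃ H : ℝ, ∀ p ∈ Ω, ∀ q ∈ Ω, ‖fderiv ℝ h p - fderiv ℝ h q‖ ≤ H * dist p q ^ α

/-- Frozen first-order intrinsic Taylor polynomial P_{x₀}h. -/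
def Pfroz (s11 s12 : ℝ × ℝ × ℝ → ℝ) (ε : ℝ) (u h : ℝ × ℝ → ℝ) (x0 x : ℝ × ℝ) : ℝ :=
  h x0 +
    ((pd3 s12 (x0.1, x0.2, u x0) /
        (s11 (x0.1, x0.2, u x0) * pd3 s12 (x0.1, x0.2, u x0) -
          s12 (x0.1, x0.2, u x0) * pd3 s11 (x0.1, x0.2, u x0))) * (x - x0).1 -
      (pd3 s11 (x0.1, x0.2, u x0) /
        (s11 (x0.1, x0.2, u x0) * pd3 s12 (x0.1, x0.2, u x0) -
          s12 (x0.1, x0.2, u x0) * pd3 s11 (x0.1, x0.2, u x0))) * (x - x0).2) *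
      X1 s11 s12 u h x0 +
    ((1 / ε) *
      ((s11 (x0.1, x0.2, u x0) /
          (s11 (x0.1, x0.2, u x0) * pd3 s12 (x0.1, x0.2, u x0) -
            s12 (x0.1, x0.2, u x0) * pd3 s11 (x0.1, x0.2, u x0))) * (x - x0).2 -
        (s12 (x0.1, x0.2, u x0) /
          (s11 (x0.1, x0.2, u x0) * pd3 s12 (x0.1, x0.2, u x0) -
            s12 (x0.1, x0.2, u x0) * pd3 s11 (x0.1, x0.2, u x0))) * (x - x0).1)) *
      X2 s11 s12 ε u h x0

open scoped NNReal ENNReal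

/-- `Φ` is the forward flow of `V` on the time interval `[0, T]`. -/
def IsFlowOn (T : ℝ) (V : ℝ × ℝ → ℝ × ℝ) (Φ : ℝ → ℝ × ℝ → ℝ × ℝ) : Prop :=
  ∀ x, Φ 0 x = x ∧ ∀ t ∈ Set.Icc 0 T,
    HasDerivWithinAt (fun s => Φ s x) (V (Φ t x)) (Set.Icc 0 T) t

lemma flow_exists {T : ℝ} (hT : 0 < T) {V : ℝ × ℝ → ℝ × ℝ} {L M : ℝ≥0} (hL : LipschitzWith L V)
    (hM : ∀ x, ‖V x‖ ≤ M) : ∃ Φ, IsFlowOn T V Φ := by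
  have key : ∀ x : ℝ × ℝ, ∃ γ : ℝ → ℝ × ℝ, γ 0 = x ∧ ∀ t ∈ Set.Icc 0 T,
      HasDerivWithinAt γ (V (γ t)) (Set.Icc 0 T) t := by
    intro x
    have hp : IsPicardLindelof (fun _ => V) (tmin := 0) (tmax := T) ⟨0, le_rfl, hT.le⟩ x
        (M * T.toNNReal) 0 M L := by
      refine ⟨fun t _ => hL.lipschitzOnWith, fun x _ => continuousOn_const, fun t _ x _ => hM x, ?_⟩
      simp only [sub_zero, sub_self, hT.le, max_eq_left, NNReal.coe_zero]
      rw [NNReal.coe_mul, Real.coe_toNNReal _ hT.le]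
    exact hp.exists_eq_forall_mem_Icc_hasDerivWithinAt₀
  choose γ h0 h1 using key
  exact ⟨fun t x => γ x t, fun x => ⟨h0 x, h1 x⟩⟩

namespace IsFlowOn

variable {T : ℝ} {V : ℝ × ℝ → ℝ × ℝ} {Φ : ℝ → ℝ × ℝ → ℝ × ℝ} {L M : ℝ≥0}

lemma contOn (h : IsFlowOn T V Φ) (x : ℝ × ℝ) : ContinuousOn (fun s => Φ s x) (Set.Icc 0 T) :=
  fun t ht => ((h x).2 t ht).continuousWithinAt

lemma derivR (h : IsFlowOn T V Φ) (x : ℝ × ℝ) {t : ℝ} (ht : t ∈ Set.Ico 0 T) :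
    HasDerivWithinAt (fun s => Φ s x) (V (Φ t x)) (Set.Ici t) t :=
  ((h x).2 t ⟨ht.1, ht.2.le⟩).mono_of_mem_nhdsWithin (by
    have : Set.Icc t T ∈ nhdsWithin t (Set.Ici t) := Icc_mem_nhdsGE ht.2
    exact Filter.mem_of_superset this (Set.Icc_subset_Icc_left ht.1))

lemma derivL (h : IsFlowOn T V Φ) (x : ℝ × ℝ) {t : ℝ} (ht : t ∈ Set.Ioc 0 T) :
    HasDerivWithinAt (fun s => Φ s x) (V (Φ t x)) (Set.Iic t) t :=
  ((h x).2 t ⟨ht.1.le, ht.2⟩).mono_of_mem_nhdsWithin (by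
    have : Set.Icc 0 t ∈ nhdsWithin t (Set.Iic t) := Icc_mem_nhdsLE ht.1
    exact Filter.mem_of_superset this (Set.Icc_subset_Icc_right ht.2))

lemma dist_self_le (h : IsFlowOn T V Φ) (hM : ∀ x, ‖V x‖ ≤ M) (x : ℝ × ℝ) {t : ℝ}
    (ht : t ∈ Set.Icc 0 T) : dist (Φ t x) x ≤ M * t := by
  have := norm_image_sub_le_of_norm_deriv_right_le_segment (C := M) (h.contOn x)
    (fun t ht => h.derivR x ht) (fun t _ => hM _) t ht
  rw [dist_eq_norm]
  simpa [(h x).1] using this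

lemma dist_le (h : IsFlowOn T V Φ) (hL : LipschitzWith L V) (x y : ℝ × ℝ) {t : ℝ}
    (ht : t ∈ Set.Icc 0 T) : dist (Φ t x) (Φ t y) ≤ Real.exp (L * T) * dist x y := by
  have := dist_le_of_trajectories_ODE (v := fun _ => V) (fun _ => hL) (h.contOn x)
    (fun t ht => h.derivR x ht) (h.contOn y)
    (fun t ht => h.derivR y ht) (le_refl _) t ht
  rw [(h x).1, (h y).1] at this
  refine this.trans ?_
  rw [mul_comm]
  have := ht.2
  gcongr
  linarith

lemma le_dist (h : IsFlowOn T V Φ) (hL : LipschitzWith L V) (x y : ℝ × ℝ) {t : ℝ}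
    (ht : t ∈ Set.Icc 0 T) : dist x y ≤ Real.exp (L * T) * dist (Φ t x) (Φ t y) := by
  have hsub : ∀ s ∈ Set.Icc 0 t, t - s ∈ Set.Icc 0 T := fun s hs =>
    ⟨by linarith [hs.2], by linarith [hs.1, ht.2]⟩
  have c : ∀ x, ContinuousOn (fun s => Φ (t - s) x) (Set.Icc 0 t) := fun x =>
    (h.contOn x).comp (by fun_prop) hsub
  have d : ∀ x, ∀ s ∈ Set.Ico 0 t,
      HasDerivWithinAt (fun s => Φ (t - s) x) ((fun z => - V z) (Φ (t - s) x)) (Set.Ici s) s := by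
    intro x s hs
    have h1 := h.derivL x (t := t - s) ⟨by linarith [hs.2], by linarith [hs.1, ht.2]⟩
    have h2 : HasDerivWithinAt (fun s => t - s) (-1) (Set.Ici s) s :=
      ((hasDerivAt_id s).const_sub t).hasDerivWithinAt
    have := HasDerivWithinAt.scomp s h1 h2 (fun r hr => by
      simp only [Set.mem_Iic, Set.mem_Ici] at *; linarith)
    simpa [Function.comp_def] using this
  have := dist_le_of_trajectories_ODE (v := fun _ => fun z => - V z) (K := L)
    (fun _ => hL.neg) (c x) (d x) (c y) (d y) (le_refl _) t ⟨ht.1, le_rfl⟩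
  simp only [sub_self, sub_zero, (h x).1, (h y).1] at this
  refine this.trans ?_
  rw [mul_comm]
  have := ht.2
  gcongr

lemma lintegral_comp_le (h : IsFlowOn T V Φ) (hL : LipschitzWith L V) {t : ℝ}
    (ht : t ∈ Set.Icc 0 T) {F : ℝ × ℝ → ℝ≥0∞} (hF : Measurable F) :
    ∫⁻ x, F (Φ t x) ≤ ENNReal.ofReal (Real.exp (L * T)) ^ (2 : ℝ) * ∫⁻ x, F x := by
  have hlip : LipschitzWith (Real.exp (L * T)).toNNReal (Φ t) := by
    refine LipschitzWith.of_dist_le_mul fun x y => ?_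
    rw [Real.coe_toNNReal _ (Real.exp_pos _).le]
    exact h.dist_le hL x y ht
  have hanti : AntilipschitzWith (Real.exp (L * T)).toNNReal (Φ t) := by
    refine AntilipschitzWith.of_le_mul_dist fun x y => ?_
    rw [Real.coe_toNNReal _ (Real.exp_pos _).le]
    exact h.le_dist hL x y ht
  have hm : Measurable (Φ t) := hlip.continuous.measurable
  have hle : Measure.map (Φ t) (volume : Measure (ℝ × ℝ)) ≤
      (ENNReal.ofReal (Real.exp (L * T)) ^ (2 : ℝ)) • (volume : Measure (ℝ × ℝ)) := by
    rw [Measure.le_iff]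
    intro s hs
    rw [Measure.map_apply hm hs]
    have := hanti.hausdorffMeasure_preimage_le (d := 2) (by norm_num) s
    rw [hausdorffMeasure_prod_real] at this
    simpa [ENNReal.ofReal] using this
  rw [← lintegral_map hF hm]
  refine (lintegral_mono' hle le_rfl).trans ?_
  rw [lintegral_smul_measure]; simp

lemma jointCont (h : IsFlowOn T V Φ) (hL : LipschitzWith L V) :
    ContinuousOn (fun p : ℝ × (ℝ × ℝ) => Φ p.1 p.2) (Set.Icc 0 T ×ˢ Set.univ) := by
  have := continuousOn_prod_of_continuousOn_lipschitzOnWith' (s := Set.Icc 0 T)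
    (t := (Set.univ : Set (ℝ × ℝ))) (fun p : ℝ × (ℝ × ℝ) => Φ p.1 p.2)
    (Real.exp (L * T)).toNNReal (fun a ha => ?_) (fun b _ => h.contOn b)
  · exact this
  · refine LipschitzOnWith.of_dist_le_mul fun x _ y _ => ?_
    rw [Real.coe_toNNReal _ (Real.exp_pos _).le]
    exact h.dist_le hL x y ha

lemma tendsto_of (h : IsFlowOn T V Φ) (hL : LipschitzWith L V)
    {Vn : ℕ → ℝ × ℝ → ℝ × ℝ} {Φn : ℕ → ℝ → ℝ × ℝ → ℝ × ℝ} (hn : ∀ n, IsFlowOn T (Vn n) (Φn n))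
    {δ : ℕ → ℝ} (hδ : Tendsto δ atTop (𝓝 0)) (hV : ∀ n x, dist (Vn n x) (V x) ≤ δ n)
    (x : ℝ × ℝ) {t : ℝ} (ht : t ∈ Set.Icc 0 T) :
    Tendsto (fun n => Φn n t x) atTop (𝓝 (Φ t x)) := by
  have key : ∀ n, dist (Φn n t x) (Φ t x) ≤ gronwallBound 0 L (δ n + 0) (t - 0) := fun n =>
    dist_le_of_approx_trajectories_ODE (v := fun _ => V) (fun _ => hL) ((hn n).contOn x)
      (fun t ht => (hn n).derivR x ht) (fun t _ => hV n _) (h.contOn x)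
      (fun t ht => h.derivR x ht) (fun t _ => by simp) (by rw [((hn n) x).1, (h x).1]; simp) t ht
  rw [tendsto_iff_dist_tendsto_zero]
  refine squeeze_zero (fun _ => dist_nonneg) key ?_
  have hc := (gronwallBound_continuous_ε 0 L (t - 0)).tendsto 0
  rw [gronwallBound_ε0_δ0] at hc
  refine hc.comp ?_
  simpa using hδ

end IsFlowOn

lemma pd1_smooth {f : ℝ × ℝ → ℝ} (hf : ContDiff ℝ (⊤ : ℕ∞) f) : ContDiff ℝ (⊤ : ℕ∞) (pd1 f) :=
  (hf.fderiv_right (m := (⊤ : ℕ∞)) (by simp)).clm_apply contDiff_const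

lemma pd2_smooth {f : ℝ × ℝ → ℝ} (hf : ContDiff ℝ (⊤ : ℕ∞) f) : ContDiff ℝ (⊤ : ℕ∞) (pd2 f) :=
  (hf.fderiv_right (m := (⊤ : ℕ∞)) (by simp)).clm_apply contDiff_const

lemma pd3_smooth {f : ℝ × ℝ × ℝ → ℝ} (hf : ContDiff ℝ (⊤ : ℕ∞) f) :
    ContDiff ℝ (⊤ : ℕ∞) (pd3 f) :=
  (hf.fderiv_right (m := (⊤ : ℕ∞)) (by simp)).clm_apply contDiff_const

lemma sm_diff {E : Type*} [NormedAddCommGroup E] [NormedSpace ℝ E] {f : E → ℝ}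
    (hf : ContDiff ℝ (⊤ : ℕ∞) f) : Differentiable ℝ f :=
  hf.differentiable (by simp)

lemma pd_comm {f : ℝ × ℝ → ℝ} (hf : ContDiff ℝ (⊤ : ℕ∞) f) (p : ℝ × ℝ) :
    pd1 (pd2 f) p = pd2 (pd1 f) p := by
  have h1 : ContDiff ℝ (⊤ : ℕ∞) (fderiv ℝ f) := hf.fderiv_right (m := (⊤ : ℕ∞)) (by simp)
  have hd : DifferentiableAt ℝ (fderiv ℝ f) p := (h1.differentiable (by simp)) p
  have e : ∀ v w : ℝ × ℝ, fderiv ℝ (fun q => fderiv ℝ f q v) p w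
      = fderiv ℝ (fderiv ℝ f) p w v := by
    intro v w
    rw [fderiv_clm_apply hd (by fun_prop)]
    simp
  have hs : IsSymmSndFDerivAt ℝ f p :=
    (hf.contDiffAt (x := p)).isSymmSndFDerivAt (by simp; exact WithTop.coe_le_coe.mpr (le_top : (2 : ℕ∞) ≤ ⊤))
  show fderiv ℝ (fun q => fderiv ℝ f q (0, 1)) p (1, 0)
    = fderiv ℝ (fun q => fderiv ℝ f q (1, 0)) p (0, 1)
  rw [e, e]
  exact hs _ _

lemma pd1_mul {f g : ℝ × ℝ → ℝ} (hf : ContDiff ℝ (⊤ : ℕ∞) f) (hg : ContDiff ℝ (⊤ : ℕ∞) g)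
    (p : ℝ × ℝ) : pd1 (fun q => f q * g q) p = pd1 f p * g p + f p * pd1 g p := by
  unfold pd1
  rw [fderiv_fun_mul (sm_diff hf p) (sm_diff hg p)]
  simp; ring

lemma pd2_mul {f g : ℝ × ℝ → ℝ} (hf : ContDiff ℝ (⊤ : ℕ∞) f) (hg : ContDiff ℝ (⊤ : ℕ∞) g)
    (p : ℝ × ℝ) : pd2 (fun q => f q * g q) p = pd2 f p * g p + f p * pd2 g p := by
  unfold pd2
  rw [fderiv_fun_mul (sm_diff hf p) (sm_diff hg p)]
  simp; ring

lemma pd1_add {f g : ℝ × ℝ → ℝ} (hf : ContDiff ℝ (⊤ : ℕ∞) f) (hg : ContDiff ℝ (⊤ : ℕ∞) g)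
    (p : ℝ × ℝ) : pd1 (fun q => f q + g q) p = pd1 f p + pd1 g p := by
  unfold pd1
  rw [fderiv_fun_add (sm_diff hf p) (sm_diff hg p)]
  simp

lemma pd2_add {f g : ℝ × ℝ → ℝ} (hf : ContDiff ℝ (⊤ : ℕ∞) f) (hg : ContDiff ℝ (⊤ : ℕ∞) g)
    (p : ℝ × ℝ) : pd2 (fun q => f q + g q) p = pd2 f p + pd2 g p := by
  unfold pd2
  rw [fderiv_fun_add (sm_diff hf p) (sm_diff hg p)]
  simp

lemma pd1_sub {f g : ℝ × ℝ → ℝ} (hf : ContDiff ℝ (⊤ : ℕ∞) f) (hg : ContDiff ℝ (⊤ : ℕ∞) g)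
    (p : ℝ × ℝ) : pd1 (fun q => f q - g q) p = pd1 f p - pd1 g p := by
  unfold pd1
  rw [fderiv_fun_sub (sm_diff hf p) (sm_diff hg p)]
  simp

lemma pd2_sub {f g : ℝ × ℝ → ℝ} (hf : ContDiff ℝ (⊤ : ℕ∞) f) (hg : ContDiff ℝ (⊤ : ℕ∞) g)
    (p : ℝ × ℝ) : pd2 (fun q => f q - g q) p = pd2 f p - pd2 g p := by
  unfold pd2
  rw [fderiv_fun_sub (sm_diff hf p) (sm_diff hg p)]
  simp

lemma pd1_cmul (r : ℝ) {f : ℝ × ℝ → ℝ} (hf : ContDiff ℝ (⊤ : ℕ∞) f)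
    (p : ℝ × ℝ) : pd1 (fun q => r * f q) p = r * pd1 f p := by
  unfold pd1
  rw [fderiv_const_mul (sm_diff hf p)]
  simp

lemma pd2_cmul (r : ℝ) {f : ℝ × ℝ → ℝ} (hf : ContDiff ℝ (⊤ : ℕ∞) f)
    (p : ℝ × ℝ) : pd2 (fun q => r * f q) p = r * pd2 f p := by
  unfold pd2
  rw [fderiv_const_mul (sm_diff hf p)]
  simp

/-- The pointwise algebraic inequality behind the energy estimate. -/
lemma pointwise_ineq {M c0 : ℝ} (hM : 1 ≤ M) (hc0 : 0 < c0)
    {a b c d f1 f2 g1 g2 φ φ1 φ2 Δ1 Δ2 f g ε k : ℝ} (hε : 0 < ε) (hε1 : ε ≤ 1)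
    (ha : |a| ≤ M) (hb : |b| ≤ M) (hc : |c| ≤ M) (hd : |d| ≤ M)
    (hφ : |φ| ≤ 1) (hφ1 : |φ1| ≤ M) (hφ2 : |φ2| ≤ M) (hΔ1 : |Δ1| ≤ M) (hΔ2 : |Δ2| ≤ M)
    (hΔM : |a * d - b * c| ≤ M) (hΔ : c0 ≤ |a * d - b * c|)
    (hf : |f| ≤ M) (hg : |g| ≤ ε * M) (hk : |k| ≤ M)
    (hcomm : ε * (c * f1 + d * f2) - (a * g1 + b * g2) = ε * k)
    (heq : (1 + g ^ 2) * (a * f1 + b * f2) - f * g * ((a * g1 + b * g2) + ε * (c * f1 + d * f2))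
      + (1 + f ^ 2) * (ε * (c * g1 + d * g2)) = 0) :
    φ ^ 2 * (a * f1 + b * f2) ^ 2 ≤ 2 * (1 + M ^ 2) *
      (ε * (g * ((2 * φ * φ1 * (a * d - b * c) + φ ^ 2 * Δ1) * f2
        - (2 * φ * φ2 * (a * d - b * c) + φ ^ 2 * Δ2) * f1)
        + φ ^ 2 * (a * d - b * c) * (g1 * f2 - g2 * f1)))
      + 2 * ((1 + M ^ 2) ^ 2 * (6 * M ^ 4 / c0) ^ 2 + (1 + M ^ 2) * (6 * M ^ 4 / c0) * M
        + (1 + M ^ 2) * M ^ 2) * ε ^ 2 := by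
  set A := a * f1 + b * f2 with hA
  set E := c * f1 + d * f2 with hE
  set B := a * g1 + b * g2 with hB
  set D := c * g1 + d * g2 with hD
  set Δ := a * d - b * c with hΔd
  set s := (B + ε * E) / 2 with hs
  set Q := 6 * M ^ 4 / c0 with hQ
  set N := 1 + M ^ 2 with hN
  have hQ0 : 0 ≤ Q := by positivity
  have hN1 : 1 ≤ N := by rw [hN]; linarith [sq_nonneg M]
  have hBs : B = s - ε * k / 2 := by rw [hs]; linarith
  have hEs : ε * E = s + ε * k / 2 := by rw [hs]; linarith
  -- step one
  have h1 : A ^ 2 + s ^ 2 ≤ (1 + f ^ 2) * (B * (ε * E) - A * (ε * D) + ε ^ 2 * k ^ 2 / 4) := by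
    have e1 : B * (ε * E) = s ^ 2 - ε ^ 2 * k ^ 2 / 4 := by rw [hBs, hEs]; ring
    have e2 : (1 + f ^ 2) * (ε * D) = 2 * f * g * s - (1 + g ^ 2) * A := by rw [hs]; linarith
    have e3 : (1 + f ^ 2) * (B * (ε * E) - A * (ε * D) + ε ^ 2 * k ^ 2 / 4)
        = A ^ 2 + s ^ 2 + (g * A - f * s) ^ 2 := by
      rw [e1]
      linear_combination (-A) * e2
    rw [e3]; linarith [sq_nonneg (g * A - f * s)]
  have hf2 : f ^ 2 ≤ M ^ 2 := sq_le_sq' (by linarith [(abs_le.1 hf).1]) (abs_le.1 hf).2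
  have hk2 : k ^ 2 ≤ M ^ 2 := sq_le_sq' (by linarith [(abs_le.1 hk).1]) (abs_le.1 hk).2
  have hP0 : 0 ≤ B * (ε * E) - A * (ε * D) + ε ^ 2 * k ^ 2 / 4 := by
    have h0 : 0 ≤ (1 + f ^ 2) * (B * (ε * E) - A * (ε * D) + ε ^ 2 * k ^ 2 / 4) :=
      le_trans (by positivity) h1
    exact nonneg_of_mul_nonneg_right h0 (by positivity)
  have h2 : A ^ 2 + s ^ 2 ≤ N * (B * (ε * E) - A * (ε * D)) + N * M ^ 2 * ε ^ 2 := by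
    have : (1 + f ^ 2) * (B * (ε * E) - A * (ε * D) + ε ^ 2 * k ^ 2 / 4) ≤
        N * (B * (ε * E) - A * (ε * D) + ε ^ 2 * k ^ 2 / 4) :=
      mul_le_mul_of_nonneg_right (by rw [hN]; linarith) hP0
    have h3 : ε ^ 2 * k ^ 2 / 4 ≤ ε ^ 2 * M ^ 2 := by
      have := mul_le_mul_of_nonneg_left hk2 (sq_nonneg ε)
      have : 0 ≤ ε ^ 2 * k ^ 2 := by positivity
      linarith
    have h4 := mul_le_mul_of_nonneg_left h3 (by linarith : (0:ℝ) ≤ N)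
    linarith
  -- step two: bound of the remainder
  have hdet : B * (ε * E) - A * (ε * D) = ε * (Δ * (g1 * f2 - g2 * f1)) := by
    rw [hB, hE, hA, hD, hΔd]; ring
  set θ1 := 2 * φ1 * Δ + φ * Δ1 with hθ1
  set θ2 := 2 * φ2 * Δ + φ * Δ2 with hθ2
  have bθ : ∀ x y : ℝ, |x| ≤ M → |y| ≤ M → |2 * x * Δ + φ * y| ≤ 3 * M ^ 2 := by
    intro x y hx hy
    have t1 : |2 * x * Δ| ≤ 2 * M * M := by
      rw [abs_mul, abs_mul, abs_two]; gcongr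
    have t2 : |φ * y| ≤ 1 * M := by rw [abs_mul]; gcongr
    have := abs_add_le (2 * x * Δ) (φ * y)
    have hMM : M ≤ M * M := le_mul_of_one_le_left (by linarith) hM
    have : M ^ 2 = M * M := sq M
    linarith
  have bθ1 := bθ φ1 Δ1 hφ1 hΔ1
  have bθ2 := bθ φ2 Δ2 hφ2 hΔ2
  have hf1 : |f1| ≤ M * (|A| + |E|) / c0 := by
    rw [le_div_iff₀ hc0]
    have e : Δ * f1 = d * A - b * E := by rw [hA, hE, hΔd]; ring
    have : |Δ * f1| ≤ M * (|A| + |E|) := by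
      rw [e]
      calc |d * A - b * E| ≤ |d * A| + |b * E| := abs_sub _ _
        _ = |d| * |A| + |b| * |E| := by rw [abs_mul, abs_mul]
        _ ≤ M * |A| + M * |E| := by gcongr
        _ = _ := by ring
    rw [abs_mul] at this
    have := mul_le_mul_of_nonneg_right hΔ (abs_nonneg f1)
    linarith
  have hf2' : |f2| ≤ M * (|A| + |E|) / c0 := by
    rw [le_div_iff₀ hc0]
    have e : Δ * f2 = a * E - c * A := by rw [hA, hE, hΔd]; ring
    have : |Δ * f2| ≤ M * (|A| + |E|) := by
      rw [e]
      calc |a * E - c * A| ≤ |a * E| + |c * A| := abs_sub _ _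
        _ = |a| * |E| + |c| * |A| := by rw [abs_mul, abs_mul]
        _ ≤ M * |E| + M * |A| := by gcongr
        _ = _ := by ring
    rw [abs_mul] at this
    have := mul_le_mul_of_nonneg_right hΔ (abs_nonneg f2)
    linarith
  set R := ε * (g * (φ * (θ1 * f2 - θ2 * f1))) with hR
  have hR1 : |R| ≤ Q * ε * |φ| * (|A| + ε * |E|) := by
    have e1 : |θ1 * f2 - θ2 * f1| ≤ 3 * M ^ 2 * (M * (|A| + |E|) / c0) * 2 := by
      calc |θ1 * f2 - θ2 * f1| ≤ |θ1 * f2| + |θ2 * f1| := abs_sub _ _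
        _ = |θ1| * |f2| + |θ2| * |f1| := by rw [abs_mul, abs_mul]
        _ ≤ 3 * M ^ 2 * (M * (|A| + |E|) / c0) + 3 * M ^ 2 * (M * (|A| + |E|) / c0) := by
            gcongr
        _ = _ := by ring
    calc |R| = ε * (|g| * (|φ| * |θ1 * f2 - θ2 * f1|)) := by
          rw [hR, abs_mul, abs_mul, abs_mul, abs_of_pos hε]
      _ ≤ ε * ((ε * M) * (|φ| * (3 * M ^ 2 * (M * (|A| + |E|) / c0) * 2))) := by gcongr
      _ = Q * ε * |φ| * (ε * |A| + ε * |E|) := by rw [hQ]; field_simp; ring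
      _ ≤ Q * ε * |φ| * (1 * |A| + ε * |E|) := by gcongr
      _ = _ := by ring
  have hεE : ε * |E| ≤ |s| + ε * M := by
    have : ε * |E| = |s + ε * k / 2| := by rw [← hEs, abs_mul, abs_of_pos hε]
    rw [this]
    refine (abs_add_le _ _).trans ?_
    have : |ε * k / 2| ≤ ε * M := by
      rw [abs_div, abs_mul, abs_of_pos hε, abs_two]
      have := mul_le_mul_of_nonneg_left hk hε.le
      have : 0 ≤ ε * |k| := by positivity
      linarith
    linarith
  have hR2 : N * |R| ≤ φ ^ 2 * (A ^ 2 + s ^ 2) / 2 + (N ^ 2 * Q ^ 2 + N * Q * M) * ε ^ 2 := by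
    have i1 : N * |R| ≤ N * (Q * ε * |φ| * (|A| + (|s| + ε * M))) := by
      refine mul_le_mul_of_nonneg_left (hR1.trans ?_) (by linarith)
      gcongr
    have i2 : N * (Q * ε * |φ| * (|A| + (|s| + ε * M))) =
        (N * Q * ε) * (|φ| * |A|) + (N * Q * ε) * (|φ| * |s|) + N * Q * M * ε ^ 2 * |φ| := by ring
    have i3 : (N * Q * ε) * (|φ| * |A|) ≤ ((N * Q * ε) ^ 2 + φ ^ 2 * A ^ 2) / 2 := by
      have := sq_nonneg (N * Q * ε - |φ| * |A|)
      have h : (|φ| * |A|) ^ 2 = φ ^ 2 * A ^ 2 := by rw [mul_pow, sq_abs, sq_abs]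
      linarith [sub_sq (N * Q * ε) (|φ| * |A|)]
    have i4 : (N * Q * ε) * (|φ| * |s|) ≤ ((N * Q * ε) ^ 2 + φ ^ 2 * s ^ 2) / 2 := by
      have := sq_nonneg (N * Q * ε - |φ| * |s|)
      have h : (|φ| * |s|) ^ 2 = φ ^ 2 * s ^ 2 := by rw [mul_pow, sq_abs, sq_abs]
      linarith [sub_sq (N * Q * ε) (|φ| * |s|)]
    have i5 : N * Q * M * ε ^ 2 * |φ| ≤ N * Q * M * ε ^ 2 :=
      mul_le_of_le_one_right (by positivity) hφ
    linarith [mul_pow (N * Q) ε 2, mul_pow N Q 2, congrArg (fun z => z * ε ^ 2) (mul_pow N Q 2)]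
  have hdiv : ε * (g * ((2 * φ * φ1 * Δ + φ ^ 2 * Δ1) * f2 - (2 * φ * φ2 * Δ + φ ^ 2 * Δ2) * f1)
      + φ ^ 2 * Δ * (g1 * f2 - g2 * f1)) = R + φ ^ 2 * (B * (ε * E) - A * (ε * D)) := by
    rw [hdet, hR, hθ1, hθ2]; ring
  rw [hdiv]
  have hφ2' : φ ^ 2 ≤ 1 := by
    rw [← sq_abs]; exact pow_le_one₀ (abs_nonneg φ) hφ
  have h5 : φ ^ 2 * (A ^ 2 + s ^ 2) ≤
      N * (φ ^ 2 * (B * (ε * E) - A * (ε * D))) + N * M ^ 2 * ε ^ 2 := by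
    have := mul_le_mul_of_nonneg_left h2 (sq_nonneg φ)
    have h6 : φ ^ 2 * (N * M ^ 2 * ε ^ 2) ≤ N * M ^ 2 * ε ^ 2 :=
      mul_le_of_le_one_left (by positivity) hφ2'
    linarith
  have h7 : -(N * R) ≤ N * |R| := by
    have := neg_abs_le R
    have := mul_le_mul_of_nonneg_left this (by linarith : (0:ℝ) ≤ N)
    linarith
  have h8 : 0 ≤ φ ^ 2 * s ^ 2 := by positivity
  linarith

lemma integral_fderiv_zero {F : ℝ × ℝ → ℝ} (hF : ContDiff ℝ (⊤ : ℕ∞) F)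
    (hc : HasCompactSupport F) (v : ℝ × ℝ) : ∫ x, fderiv ℝ F x v = 0 := by
  obtain ⟨D, hD⟩ := ContDiff.lipschitzWith_of_hasCompactSupport hc hF (by simp)
  have h1 : LipschitzWith 0 (fun _ : ℝ × ℝ => (1 : ℝ)) := LipschitzWith.const 1
  have := h1.integral_lineDeriv_mul_eq (μ := volume) hD hc (-v)
  have e : ∀ x, lineDeriv ℝ (fun _ : ℝ × ℝ => (1 : ℝ)) x (-v) = 0 := by
    intro x; simp [lineDeriv]
  simp only [e, zero_mul, integral_zero, neg_neg, mul_one] at this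
  rw [this]
  refine integral_congr_ae (Eventually.of_forall fun x => ?_)
  exact ((sm_diff hF x).lineDeriv_eq_fderiv).symm

lemma pd_zero_of_not_mem {F : ℝ × ℝ → ℝ} {p : ℝ × ℝ} (h : p ∉ tsupport F) :
    pd1 F p = 0 ∧ pd2 F p = 0 := by
  have : fderiv ℝ F p = 0 := by
    by_contra hne
    exact h (support_fderiv_subset ℝ (Function.mem_support.2 hne))
  simp [pd1, pd2, this]

/-- The energy estimate: `∫ φ² (X X u)² ≤ C ε²`. -/
lemma energy {M c0 : ℝ} (hM : 1 ≤ M) (hc0 : 0 < c0) :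
    ∃ C : ℝ, 0 ≤ C ∧ ∀ (a b c d u φ : ℝ × ℝ → ℝ) (ε : ℝ), 0 < ε → ε ≤ 1 →
      ContDiff ℝ (⊤ : ℕ∞) a → ContDiff ℝ (⊤ : ℕ∞) b → ContDiff ℝ (⊤ : ℕ∞) c →
      ContDiff ℝ (⊤ : ℕ∞) d → ContDiff ℝ (⊤ : ℕ∞) u → ContDiff ℝ (⊤ : ℕ∞) φ →
      HasCompactSupport φ → ∀ f g : ℝ × ℝ → ℝ,
      (f = fun p => a p * pd1 u p + b p * pd2 u p) →
      (g = fun p => ε * (c p * pd1 u p + d p * pd2 u p)) →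
      (∀ p ∈ tsupport φ, (|φ p| ≤ 1 ∧ |pd1 φ p| ≤ M ∧ |pd2 φ p| ≤ M) ∧
        (|a p| ≤ M ∧ |b p| ≤ M ∧ |c p| ≤ M ∧ |d p| ≤ M) ∧
        (|pd1 a p| ≤ M ∧ |pd1 b p| ≤ M ∧ |pd1 c p| ≤ M ∧ |pd1 d p| ≤ M) ∧
        (|pd2 a p| ≤ M ∧ |pd2 b p| ≤ M ∧ |pd2 c p| ≤ M ∧ |pd2 d p| ≤ M) ∧
        (|pd1 u p| ≤ M ∧ |pd2 u p| ≤ M) ∧ c0 ≤ |a p * d p - b p * c p|) →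
      (∀ p ∈ tsupport φ, (1 + g p ^ 2) * (a p * pd1 f p + b p * pd2 f p)
        - f p * g p * ((a p * pd1 g p + b p * pd2 g p) + ε * (c p * pd1 f p + d p * pd2 f p))
        + (1 + f p ^ 2) * (ε * (c p * pd1 g p + d p * pd2 g p)) = 0) →
      ∫ p, φ p ^ 2 * (a p * pd1 f p + b p * pd2 f p) ^ 2
        ≤ C * ε ^ 2 * (volume (tsupport φ)).toReal := by
  set M' := 8 * M ^ 3 with hM'
  have hM0 : 0 ≤ M := by linarith
  have hMM2 : M ≤ M ^ 2 := by nlinarith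
  have hMM3 : M ^ 2 ≤ M ^ 3 := by nlinarith
  have hM'1 : 1 ≤ M' := by rw [hM']; linarith
  have hMM' : M ≤ M' := by rw [hM']; linarith
  refine ⟨2 * ((1 + M' ^ 2) ^ 2 * (6 * M' ^ 4 / c0) ^ 2 + (1 + M' ^ 2) * (6 * M' ^ 4 / c0) * M'
        + (1 + M' ^ 2) * M' ^ 2), by positivity, ?_⟩
  set C := 2 * ((1 + M' ^ 2) ^ 2 * (6 * M' ^ 4 / c0) ^ 2 + (1 + M' ^ 2) * (6 * M' ^ 4 / c0) * M'
        + (1 + M' ^ 2) * M' ^ 2) with hC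
  intro a b c d u φ ε hε hε1 ha hb hc hd hu hφ hφc f g hf hg hbd heq
  have hu1 := pd1_smooth hu
  have hu2 := pd2_smooth hu
  have hfs : ContDiff ℝ (⊤ : ℕ∞) f := by rw [hf]; exact (ha.mul hu1).add (hb.mul hu2)
  have hhs : ContDiff ℝ (⊤ : ℕ∞) (fun p => c p * pd1 u p + d p * pd2 u p) :=
    (hc.mul hu1).add (hd.mul hu2)
  have hgs : ContDiff ℝ (⊤ : ℕ∞) g := by rw [hg]; exact contDiff_const.mul hhs
  have hf1 := pd1_smooth hfs
  have hf2 := pd2_smooth hfs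
  set Δ : ℝ × ℝ → ℝ := fun p => a p * d p - b p * c p with hΔ
  have hΔs : ContDiff ℝ (⊤ : ℕ∞) Δ := (ha.mul hd).sub (hb.mul hc)
  set ψ : ℝ × ℝ → ℝ := fun p => (φ p * φ p) * Δ p with hψ
  have hφφ : ContDiff ℝ (⊤ : ℕ∞) (fun p => φ p * φ p) := hφ.mul hφ
  have hψs : ContDiff ℝ (⊤ : ℕ∞) ψ := hφφ.mul hΔs
  have hψg : ContDiff ℝ (⊤ : ℕ∞) (fun p => ψ p * g p) := hψs.mul hgs
  set F1 : ℝ × ℝ → ℝ := fun p => (ψ p * g p) * pd2 f p with hF1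
  set F2 : ℝ × ℝ → ℝ := fun p => (ψ p * g p) * pd1 f p with hF2
  have hF1s : ContDiff ℝ (⊤ : ℕ∞) F1 := hψg.mul hf2
  have hF2s : ContDiff ℝ (⊤ : ℕ∞) F2 := hψg.mul hf1
  have supp : ∀ G : ℝ × ℝ → ℝ, (∀ p, φ p = 0 → G p = 0) → tsupport G ⊆ tsupport φ := by
    intro G hG
    refine closure_mono fun p hp => ?_
    rw [Function.mem_support] at hp ⊢
    exact fun h => hp (hG p h)
  have hF1t : tsupport F1 ⊆ tsupport φ := supp _ (fun p hp => by simp [hF1, hψ, hp])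
  have hF2t : tsupport F2 ⊆ tsupport φ := supp _ (fun p hp => by simp [hF2, hψ, hp])
  have cpt : ∀ G : ℝ × ℝ → ℝ, tsupport G ⊆ tsupport φ → HasCompactSupport G := fun G hG =>
    IsCompact.of_isClosed_subset hφc (isClosed_tsupport G) hG
  have hF1c := cpt _ hF1t
  have hF2c := cpt _ hF2t
  have i1 : ∫ x, pd1 F1 x = 0 := integral_fderiv_zero hF1s hF1c _
  have i2 : ∫ x, pd2 F2 x = 0 := integral_fderiv_zero hF2s hF2c _
  have int1 : Integrable (pd1 F1) := (pd1_smooth hF1s).continuous.integrable_of_hasCompactSupport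
    (cpt _ (by
      refine Set.Subset.trans ?_ hF1t
      exact closure_minimal (fun p hp => by
        by_contra h; exact hp (pd_zero_of_not_mem h).1) (isClosed_tsupport _)))
  have int2 : Integrable (pd2 F2) := (pd2_smooth hF2s).continuous.integrable_of_hasCompactSupport
    (cpt _ (by
      refine Set.Subset.trans ?_ hF2t
      exact closure_minimal (fun p hp => by
        by_contra h; exact hp (pd_zero_of_not_mem h).2) (isClosed_tsupport _)))
  have hdiv : ∀ p, pd1 F1 p - pd2 F2 p =
      g p * ((2 * φ p * pd1 φ p * Δ p + φ p ^ 2 * pd1 Δ p) * pd2 f p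
        - (2 * φ p * pd2 φ p * Δ p + φ p ^ 2 * pd2 Δ p) * pd1 f p)
        + φ p ^ 2 * Δ p * (pd1 g p * pd2 f p - pd2 g p * pd1 f p) := by
    intro p
    rw [hF1, hF2, pd1_mul hψg hf2, pd2_mul hψg hf1, pd1_mul hψs hgs, pd2_mul hψs hgs, hψ,
      pd1_mul hφφ hΔs, pd2_mul hφφ hΔs, pd1_mul hφ hφ, pd2_mul hφ hφ, pd_comm hfs]
    ring
  -- pointwise estimate
  have key : ∀ p, φ p ^ 2 * (a p * pd1 f p + b p * pd2 f p) ^ 2 ≤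
      2 * (1 + M' ^ 2) * (ε * (pd1 F1 p - pd2 F2 p))
        + (tsupport φ).indicator (fun _ => C * ε ^ 2) p := by
    intro p
    by_cases hp : p ∈ tsupport φ
    · rw [Set.indicator_of_mem hp, hdiv p]
      obtain ⟨⟨b1, b2, b3⟩, ⟨b4, b5, b6, b7⟩, ⟨b8, b9, b10, b11⟩, ⟨b12, b13, b14, b15⟩,
        ⟨b16, b17⟩, b18⟩ := hbd p hp
      have two : ∀ x y z w : ℝ, |x| ≤ M → |y| ≤ M → |z| ≤ M → |w| ≤ M →
          |x * y + z * w| ≤ 2 * M ^ 2 := by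
        intro x y z w hx hy hz hw
        refine (abs_add_le _ _).trans ?_
        have t1 : |x * y| ≤ M * M := by rw [abs_mul]; gcongr
        have t2 : |z * w| ≤ M * M := by rw [abs_mul]; gcongr
        linarith [sq M]
      have two' : ∀ x y z w : ℝ, |x| ≤ M → |y| ≤ M → |z| ≤ M → |w| ≤ M →
          |x * y - z * w| ≤ 2 * M ^ 2 := by
        intro x y z w hx hy hz hw
        refine (abs_sub _ _).trans ?_
        have t1 : |x * y| ≤ M * M := by rw [abs_mul]; gcongr
        have t2 : |z * w| ≤ M * M := by rw [abs_mul]; gcongr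
        linarith [sq M]
      have four : ∀ x y z w x' y' z' w' : ℝ, |x| ≤ M → |y| ≤ M → |z| ≤ M → |w| ≤ M →
          |x'| ≤ M → |y'| ≤ M → |z'| ≤ M → |w'| ≤ M →
          |(x * y + z * w) - (x' * y' + z' * w')| ≤ 4 * M ^ 2 := by
        intro x y z w x' y' z' w' h1 h2 h3 h4 h5 h6 h7 h8
        refine (abs_sub _ _).trans ?_
        linarith [two x y z w h1 h2 h3 h4, two x' y' z' w' h5 h6 h7 h8]
      have hΔ1 : pd1 Δ p = (pd1 a p * d p + a p * pd1 d p) - (pd1 b p * c p + b p * pd1 c p) := by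
        rw [hΔ, pd1_sub (ha.mul hd) (hb.mul hc), pd1_mul ha hd, pd1_mul hb hc]
      have hΔ2 : pd2 Δ p = (pd2 a p * d p + a p * pd2 d p) - (pd2 b p * c p + b p * pd2 c p) := by
        rw [hΔ, pd2_sub (ha.mul hd) (hb.mul hc), pd2_mul ha hd, pd2_mul hb hc]
      have hk : |((c p * pd1 a p + d p * pd2 a p) - (a p * pd1 c p + b p * pd2 c p)) * pd1 u p
          + ((c p * pd1 b p + d p * pd2 b p) - (a p * pd1 d p + b p * pd2 d p)) * pd2 u p|
            ≤ M' := by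
        have k1 := four (c p) (pd1 a p) (d p) (pd2 a p) (a p) (pd1 c p) (b p) (pd2 c p)
          b6 b8 b7 b12 b4 b10 b5 b14
        have k2 := four (c p) (pd1 b p) (d p) (pd2 b p) (a p) (pd1 d p) (b p) (pd2 d p)
          b6 b9 b7 b13 b4 b11 b5 b15
        refine (abs_add_le _ _).trans ?_
        rw [abs_mul, abs_mul]
        have := mul_le_mul k1 b16 (abs_nonneg _) (by positivity)
        have := mul_le_mul k2 b17 (abs_nonneg _) (by positivity)
        rw [hM']
        linarith [pow_succ M 2]
      refine pointwise_ineq (M := M') hM'1 hc0 hε hε1 (b4.trans hMM') (b5.trans hMM')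
        (b6.trans hMM') (b7.trans hMM') b1 (b2.trans hMM') (b3.trans hMM') ?_ ?_ ?_ b18 ?_ ?_ hk
        ?_ (heq p hp)
      · rw [hΔ1]
        have := four _ _ _ _ _ _ _ _ b8 b7 b4 b11 b9 b6 b5 b10
        linarith
      · rw [hΔ2]
        have := four _ _ _ _ _ _ _ _ b12 b7 b4 b15 b13 b6 b5 b14
        linarith
      · have := two' _ _ _ _ b4 b7 b5 b6
        linarith
      · rw [hf]
        have := two _ _ _ _ b4 b16 b5 b17
        linarith
      · rw [hg]
        have := two _ _ _ _ b6 b16 b7 b17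
        simp only
        rw [abs_mul, abs_of_pos hε]
        exact mul_le_mul_of_nonneg_left (by linarith) hε.le
      · rw [hf, hg, pd1_cmul ε hhs, pd2_cmul ε hhs, pd1_add (ha.mul hu1) (hb.mul hu2),
          pd2_add (ha.mul hu1) (hb.mul hu2), pd1_add (hc.mul hu1) (hd.mul hu2),
          pd2_add (hc.mul hu1) (hd.mul hu2), pd1_mul ha hu1, pd1_mul hb hu2, pd2_mul ha hu1,
          pd2_mul hb hu2, pd1_mul hc hu1, pd1_mul hd hu2, pd2_mul hc hu1, pd2_mul hd hu2,
          pd_comm hu]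
        ring
    · rw [Set.indicator_of_notMem hp, (pd_zero_of_not_mem (fun h => hp (hF1t h))).1,
        (pd_zero_of_not_mem (fun h => hp (hF2t h))).2, image_eq_zero_of_notMem_tsupport hp]
      simp
  have intL : Integrable (fun p => φ p ^ 2 * (a p * pd1 f p + b p * pd2 f p) ^ 2) := by
    refine Continuous.integrable_of_hasCompactSupport ?_ (cpt _ (supp _ fun p hp => by simp [hp]))
    exact (hφ.continuous.pow 2).mul (((ha.continuous.mul hf1.continuous).add
      (hb.continuous.mul hf2.continuous)).pow 2)
  have intI : Integrable ((tsupport φ).indicator (fun _ => C * ε ^ 2)) := by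
    rw [integrable_indicator_iff (isClosed_tsupport φ).measurableSet]
    exact integrableOn_const (hs := hφc.measure_lt_top.ne)
  have intD : Integrable (fun p => 2 * (1 + M' ^ 2) * (ε * (pd1 F1 p - pd2 F2 p))) :=
    ((int1.sub int2).const_mul ε).const_mul _
  calc ∫ p, φ p ^ 2 * (a p * pd1 f p + b p * pd2 f p) ^ 2
      ≤ ∫ p, (2 * (1 + M' ^ 2) * (ε * (pd1 F1 p - pd2 F2 p))
        + (tsupport φ).indicator (fun _ => C * ε ^ 2) p) := integral_mono intL (intD.add intI) key
    _ = C * ε ^ 2 * (volume (tsupport φ)).toReal := by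
        rw [integral_add intD intI, integral_const_mul, integral_const_mul,
          integral_sub int1 int2, i1, i2, integral_indicator (isClosed_tsupport φ).measurableSet]
        simp [Measure.real, mul_comm]

lemma graph_smooth {s : ℝ × ℝ × ℝ → ℝ} {u : ℝ × ℝ → ℝ} (hs : ContDiff ℝ (⊤ : ℕ∞) s)
    (hu : ContDiff ℝ (⊤ : ℕ∞) u) : ContDiff ℝ (⊤ : ℕ∞) (fun p : ℝ × ℝ => s (p.1, p.2, u p)) :=
  hs.comp (contDiff_fst.prodMk (contDiff_snd.prodMk hu))

lemma fderiv_quot {f g : ℝ × ℝ → ℝ} (hf : Differentiable ℝ f) (hg : Differentiable ℝ g)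
    (p v : ℝ × ℝ) :
    fderiv ℝ (fun q => f q / √(1 + (√(f q ^ 2 + g q ^ 2)) ^ 2)) p v =
      ((1 + g p ^ 2) * fderiv ℝ f p v - f p * g p * fderiv ℝ g p v) /
        (√(1 + f p ^ 2 + g p ^ 2)) ^ 3 := by
  have e : (fun q => f q / √(1 + (√(f q ^ 2 + g q ^ 2)) ^ 2)) =
      fun q => f q / √(1 + f q ^ 2 + g q ^ 2) := by
    funext q
    rw [Real.sq_sqrt (by positivity)]
    ring_nf
  rw [e]
  have hpos : 0 < 1 + f p ^ 2 + g p ^ 2 := by positivity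
  have hW : 0 < √(1 + f p ^ 2 + g p ^ 2) := Real.sqrt_pos.2 hpos
  have hF := (hf p).hasFDerivAt
  have hG := (hg p).hasFDerivAt
  have hS : HasFDerivAt (fun q => 1 + f q ^ 2 + g q ^ 2)
      ((2 * f p) • fderiv ℝ f p + (2 * g p) • fderiv ℝ g p) p := by
    have := ((hF.pow 2).const_add 1).add (hG.pow 2)
    simp at this
    exact this
  have h1 : HasFDerivAt (fun q => (√(1 + f q ^ 2 + g q ^ 2))⁻¹) _ p :=
    (HasDerivAt.inv (Real.hasDerivAt_sqrt hpos.ne') hW.ne').comp_hasFDerivAt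
      (h₂ := (fun x => √x)⁻¹) p hS
  have h2 : HasFDerivAt (fun q => f q / √(1 + f q ^ 2 + g q ^ 2)) _ p := hF.mul h1
  have hs : (√(1 + f p ^ 2 + g p ^ 2)) ^ 2 = 1 + f p ^ 2 + g p ^ 2 := Real.sq_sqrt hpos.le
  rw [h2.fderiv]
  simp
  set W := √(1 + f p ^ 2 + g p ^ 2)
  field_simp
  linear_combination (fderiv ℝ f p v) * hs

lemma eq_of_Lop {s11 s12 : ℝ × ℝ × ℝ → ℝ} {u : ℝ × ℝ → ℝ} {ε : ℝ}
    (hs11 : ContDiff ℝ (⊤ : ℕ∞) s11) (hs12 : ContDiff ℝ (⊤ : ℕ∞) s12)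
    (hu : ContDiff ℝ (⊤ : ℕ∞) u) {a b c d f g : ℝ × ℝ → ℝ}
    (ha : a = fun p => s11 (p.1, p.2, u p)) (hb : b = fun p => s12 (p.1, p.2, u p))
    (hc : c = fun p => pd3 s11 (p.1, p.2, u p)) (hd : d = fun p => pd3 s12 (p.1, p.2, u p))
    (hf : f = fun p => a p * pd1 u p + b p * pd2 u p)
    (hg : g = fun p => ε * (c p * pd1 u p + d p * pd2 u p)) {p : ℝ × ℝ}
    (h : Lop s11 s12 ε u p = 0) :
    (1 + g p ^ 2) * (a p * pd1 f p + b p * pd2 f p)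
        - f p * g p * ((a p * pd1 g p + b p * pd2 g p) + ε * (c p * pd1 f p + d p * pd2 f p))
        + (1 + f p ^ 2) * (ε * (c p * pd1 g p + d p * pd2 g p)) = 0 := by
  have sa := graph_smooth hs11 hu
  have sb := graph_smooth hs12 hu
  have sc := graph_smooth (pd3_smooth hs11) hu
  have sd := graph_smooth (pd3_smooth hs12) hu
  have s1 := pd1_smooth hu
  have s2 := pd2_smooth hu
  have sf : ContDiff ℝ (⊤ : ℕ∞) f := by
    rw [hf, ha, hb]; exact (sa.mul s1).add (sb.mul s2)
  have sg : ContDiff ℝ (⊤ : ℕ∞) g := by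
    rw [hg, hc, hd]; exact contDiff_const.mul ((sc.mul s1).add (sd.mul s2))
  have e1 : X1 s11 s12 u u = f := by rw [hf, ha, hb]; rfl
  have e2 : X2 s11 s12 ε u u = g := by rw [hg, hc, hd]; rfl
  have eW : ∀ q, Wt s11 s12 ε u q = √(1 + (√(f q ^ 2 + g q ^ 2)) ^ 2) := by
    intro q; unfold Wt gradN; rw [e1, e2]
  have eW' : ∀ q, Wt s11 s12 ε u q = √(1 + (√(g q ^ 2 + f q ^ 2)) ^ 2) := by
    intro q; rw [eW, add_comm (f q ^ 2)]
  have k1 := fderiv_quot (sm_diff sf) (sm_diff sg) p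
  have k2 := fderiv_quot (sm_diff sg) (sm_diff sf) p
  have hexp : Lop s11 s12 ε u p =
      (a p * pd1 (fun q => f q / Wt s11 s12 ε u q) p + b p * pd2 (fun q => f q / Wt s11 s12 ε u q) p)
      + ε * (c p * pd1 (fun q => g q / Wt s11 s12 ε u q) p
        + d p * pd2 (fun q => g q / Wt s11 s12 ε u q) p) := by
    unfold Lop; rw [e1, e2, ha, hb, hc, hd]; rfl
  have f1 : (fun q => f q / Wt s11 s12 ε u q) =
      fun q => f q / √(1 + (√(f q ^ 2 + g q ^ 2)) ^ 2) := by
    funext q; rw [eW]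
  have f2 : (fun q => g q / Wt s11 s12 ε u q) =
      fun q => g q / √(1 + (√(g q ^ 2 + f q ^ 2)) ^ 2) := by
    funext q; rw [eW']
  rw [h, f1, f2] at hexp
  unfold pd1 pd2 at hexp
  rw [k1, k1, k2, k2] at hexp
  have hpos : 0 < 1 + f p ^ 2 + g p ^ 2 := by positivity
  have hW : 0 < √(1 + f p ^ 2 + g p ^ 2) := Real.sqrt_pos.2 hpos
  rw [show 1 + g p ^ 2 + f p ^ 2 = 1 + f p ^ 2 + g p ^ 2 by ring] at hexp
  unfold pd1 pd2
  set W := √(1 + f p ^ 2 + g p ^ 2)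
  field_simp at hexp
  linear_combination -hexp

lemma graph_bound {Ω S : Set (ℝ × ℝ)} (hΩo : IsOpen Ω) (hS : IsCompact S) (hSΩ : S ⊆ Ω) (l : ℝ≥0)
    {s : ℝ × ℝ × ℝ → ℝ} (hs : ContDiff ℝ (⊤ : ℕ∞) s) :
    ∃ M : ℝ, 0 ≤ M ∧ ∀ u : ℝ × ℝ → ℝ, ContDiff ℝ (⊤ : ℕ∞) u → LipschitzOnWith l u Ω →
      (∀ p ∈ Ω, |u p| ≤ l) → ∀ p ∈ S, |s (p.1, p.2, u p)| ≤ M ∧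
        |pd1 (fun q => s (q.1, q.2, u q)) p| ≤ M ∧ |pd2 (fun q => s (q.1, q.2, u q)) p| ≤ M := by
  have hcomp : IsCompact (S ×ˢ Set.Icc (-(l : ℝ)) l) := hS.prod isCompact_Icc
  have hι : Continuous (fun r : (ℝ × ℝ) × ℝ => (r.1.1, r.1.2, r.2)) := by fun_prop
  obtain ⟨B1, hB1⟩ := hcomp.exists_bound_of_continuousOn
    ((hs.continuous.comp hι).continuousOn)
  obtain ⟨B2, hB2⟩ := hcomp.exists_bound_of_continuousOn
    (((hs.continuous_fderiv (by simp)).comp hι).continuousOn)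
  refine ⟨max (max B1 0) (max B2 0 * max 1 l), by positivity, ?_⟩
  intro u hu hlip hb p hp
  have hpΩ := hSΩ hp
  have hmem : (p, u p) ∈ S ×ˢ Set.Icc (-(l : ℝ)) l := ⟨hp, abs_le.1 (hb p hpΩ)⟩
  have b1 := hB1 _ hmem
  have b2 := hB2 _ hmem
  simp only [Function.comp] at b1 b2
  have hdu : ‖fderiv ℝ u p‖ ≤ l := norm_fderiv_le_of_lipschitzOn ℝ (hΩo.mem_nhds hpΩ) hlip
  have hD : HasFDerivAt (fun q : ℝ × ℝ => s (q.1, q.2, u q))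
      ((fderiv ℝ s (p.1, p.2, u p)).comp ((ContinuousLinearMap.fst ℝ ℝ ℝ).prod
        ((ContinuousLinearMap.snd ℝ ℝ ℝ).prod (fderiv ℝ u p)))) p := by
    have := (sm_diff hs (p.1, p.2, u p)).hasFDerivAt
    exact HasFDerivAt.comp (f := fun q : ℝ × ℝ => (q.1, q.2, u q)) p this
      (hasFDerivAt_fst.prodMk (hasFDerivAt_snd.prodMk (sm_diff hu p).hasFDerivAt))
  have key : ∀ v : ℝ × ℝ, ‖v‖ ≤ 1 →
      |fderiv ℝ (fun q : ℝ × ℝ => s (q.1, q.2, u q)) p v| ≤ max B2 0 * max 1 l := by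
    intro v hv
    rw [hD.fderiv]
    simp only [ContinuousLinearMap.comp_apply, ContinuousLinearMap.prod_apply]
    refine (ContinuousLinearMap.le_opNorm (fderiv ℝ s (p.1, p.2, u p)) _).trans ?_
    refine mul_le_mul (b2.trans (le_max_left _ _)) ?_ (norm_nonneg _) (by positivity)
    have h1 : ‖v.1‖ ≤ 1 := (norm_fst_le v).trans hv
    have h2 : ‖v.2‖ ≤ 1 := (norm_snd_le v).trans hv
    have h3 : ‖fderiv ℝ u p v‖ ≤ l := by
      refine (ContinuousLinearMap.le_opNorm (fderiv ℝ u p) v).trans ?_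
      calc _ ≤ (l : ℝ) * 1 := mul_le_mul hdu hv (norm_nonneg _) (by positivity)
        _ = l := mul_one _
    refine norm_prod_le_iff.2 ⟨h1.trans (le_max_left _ _), norm_prod_le_iff.2
      ⟨h2.trans (le_max_left _ _), h3.trans (le_max_right _ _)⟩⟩
  refine ⟨(b1.trans (le_max_left _ _)).trans (le_max_left _ _), ?_, ?_⟩
  · exact (key (1, 0) (by simp [Prod.norm_def])).trans (le_max_right _ _)
  · exact (key (0, 1) (by simp [Prod.norm_def])).trans (le_max_right _ _)

lemma hess_small {Ω : Set (ℝ × ℝ)} (hΩo : IsOpen Ω) (l : ℝ≥0) {s11 s12 : ℝ × ℝ × ℝ → ℝ}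
    (hs11 : ContDiff ℝ (⊤ : ℕ∞) s11) (hs12 : ContDiff ℝ (⊤ : ℕ∞) s12)
    (hrank : RankCond s11 s12) {φ : ℝ × ℝ → ℝ} (hφ : ContDiff ℝ (⊤ : ℕ∞) φ)
    (hφc : HasCompactSupport φ) (hφΩ : tsupport φ ⊆ Ω) (hφ1 : ∀ p, |φ p| ≤ 1) :
    ∃ C : ℝ, 0 ≤ C ∧ ∀ (u : ℝ × ℝ → ℝ) (ε : ℝ), 0 < ε → ε ≤ 1 → ContDiff ℝ (⊤ : ℕ∞) u →
      LipschitzOnWith l u Ω → (∀ p ∈ Ω, |u p| ≤ l) → (∀ p ∈ Ω, Lop s11 s12 ε u p = 0) →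
      ∫ p, φ p ^ 2 * (X1 s11 s12 u (X1 s11 s12 u u) p) ^ 2 ≤ C * ε ^ 2 := by
  have hS : IsCompact (tsupport φ) := hφc
  obtain ⟨Ma, ha0, hMa⟩ := graph_bound hΩo hS hφΩ l hs11
  obtain ⟨Mb, hb0, hMb⟩ := graph_bound hΩo hS hφΩ l hs12
  obtain ⟨Mc, hc0, hMc⟩ := graph_bound hΩo hS hφΩ l (pd3_smooth hs11)
  obtain ⟨Md, hd0, hMd⟩ := graph_bound hΩo hS hφΩ l (pd3_smooth hs12)
  obtain ⟨P1, hP1⟩ := hS.exists_bound_of_continuousOn (pd1_smooth hφ).continuous.continuousOn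
  obtain ⟨P2, hP2⟩ := hS.exists_bound_of_continuousOn (pd2_smooth hφ).continuous.continuousOn
  -- lower bound for the determinant
  have hcomp : IsCompact (tsupport φ ×ˢ Set.Icc (-(l : ℝ)) l) := hS.prod isCompact_Icc
  have hι : Continuous (fun r : (ℝ × ℝ) × ℝ => (r.1.1, r.1.2, r.2)) := by fun_prop
  have hdet : Continuous (fun q => |s11 q * pd3 s12 q - s12 q * pd3 s11 q|) :=
    ((hs11.continuous.mul (pd3_smooth hs12).continuous).sub
      (hs12.continuous.mul (pd3_smooth hs11).continuous)).abs
  have hlow : ∃ c0 : ℝ, 0 < c0 ∧ ∀ r ∈ tsupport φ ×ˢ Set.Icc (-(l : ℝ)) l,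
      c0 ≤ |s11 (r.1.1, r.1.2, r.2) * pd3 s12 (r.1.1, r.1.2, r.2)
        - s12 (r.1.1, r.1.2, r.2) * pd3 s11 (r.1.1, r.1.2, r.2)| := by
    rcases (tsupport φ ×ˢ Set.Icc (-(l : ℝ)) l).eq_empty_or_nonempty with he | hne
    · exact ⟨1, one_pos, by rw [he]; simp⟩
    · obtain ⟨r, hr, hmin⟩ := hcomp.exists_isMinOn hne (hdet.comp hι).continuousOn
      exact ⟨_, hrank (r.1.1, r.1.2, r.2), fun r' hr' => hmin hr'⟩
  obtain ⟨c0, hc0p, hlow⟩ := hlow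
  set M : ℝ := 1 + Ma + Mb + Mc + Md + |P1| + |P2| + l with hMdef
  have l0 : (0 : ℝ) ≤ l := l.2
  have p1 := abs_nonneg P1
  have p2 := abs_nonneg P2
  have hM1 : 1 ≤ M := by rw [hMdef]; linarith
  obtain ⟨C, hC0, hC⟩ := energy hM1 hc0p
  refine ⟨C * (volume (tsupport φ)).toReal, by positivity, ?_⟩
  intro u ε hε hε1 hu hlip hb hL
  have := hC (fun p => s11 (p.1, p.2, u p)) (fun p => s12 (p.1, p.2, u p))
    (fun p => pd3 s11 (p.1, p.2, u p)) (fun p => pd3 s12 (p.1, p.2, u p)) u φ ε hε hε1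
    (graph_smooth hs11 hu) (graph_smooth hs12 hu) (graph_smooth (pd3_smooth hs11) hu)
    (graph_smooth (pd3_smooth hs12) hu) hu hφ hφc (X1 s11 s12 u u) (X2 s11 s12 ε u u) rfl rfl
    ?_ ?_
  · calc _ ≤ _ := this
      _ = _ := by ring
  · intro p hp
    obtain ⟨a1, a2, a3⟩ := hMa u hu hlip hb p hp
    obtain ⟨b1, b2, b3⟩ := hMb u hu hlip hb p hp
    obtain ⟨c1, c2, c3⟩ := hMc u hu hlip hb p hp
    obtain ⟨d1, d2, d3⟩ := hMd u hu hlip hb p hp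
    have q1 := hP1 p hp
    have q2 := hP2 p hp
    rw [Real.norm_eq_abs] at q1 q2
    have q1' := le_abs_self P1
    have q2' := le_abs_self P2
    have hdu : ‖fderiv ℝ u p‖ ≤ l :=
      norm_fderiv_le_of_lipschitzOn ℝ (hΩo.mem_nhds (hφΩ hp)) hlip
    have key : ∀ v : ℝ × ℝ, ‖v‖ ≤ 1 → |fderiv ℝ u p v| ≤ l := by
      intro v hv
      refine (ContinuousLinearMap.le_opNorm (fderiv ℝ u p) v).trans ?_
      calc _ ≤ (l : ℝ) * 1 := mul_le_mul hdu hv (norm_nonneg _) (by positivity)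
        _ = l := mul_one _
    have u1 : |pd1 u p| ≤ l := key (1, 0) (by simp [Prod.norm_def])
    have u2 : |pd2 u p| ≤ l := key (0, 1) (by simp [Prod.norm_def])
    have hl := hlow (p, u p) ⟨hp, abs_le.1 (hb p (hφΩ hp))⟩
    refine ⟨⟨hφ1 p, ?_, ?_⟩, ⟨?_, ?_, ?_, ?_⟩, ⟨?_, ?_, ?_, ?_⟩, ⟨?_, ?_, ?_, ?_⟩, ⟨?_, ?_⟩, hl⟩ <;>
      linarith
  · intro p hp
    exact eq_of_Lop hs11 hs12 hu rfl rfl rfl rfl rfl rfl (hL p (hφΩ hp))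

lemma affine_1d {T : ℝ} (hT : 0 < T) {v f h : ℝ → ℝ} (hh : ContinuousOn h (Set.Icc 0 T))
    (hv : ∀ t ∈ Set.Icc 0 T, HasDerivWithinAt v (f t) (Set.Icc 0 T) t)
    (hf : ∀ t ∈ Set.Icc 0 T, HasDerivWithinAt f (h t) (Set.Icc 0 T) t) (k : ℕ) :
    |((k : ℝ) + 1) * (v (T / (k + 1)) - v 0) - (v T - v 0)|
      ≤ 2 * T * ∫ t in Set.Icc 0 T, |h t| := by
  set I := ∫ t in Set.Icc 0 T, |h t| with hI
  have hIntg : IntegrableOn (fun t => |h t|) (Set.Icc 0 T) :=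
    (hh.abs).integrableOn_compact isCompact_Icc
  have h1 : ∀ t ∈ Set.Icc 0 T, |f t - f 0| ≤ I := by
    intro t ht
    have hsub : Set.Icc 0 t ⊆ Set.Icc 0 T := Set.Icc_subset_Icc le_rfl ht.2
    have hii : IntervalIntegrable h volume 0 t := by
      apply ContinuousOn.intervalIntegrable
      rw [Set.uIcc_of_le ht.1]
      exact hh.mono hsub
    have e := intervalIntegral.integral_eq_sub_of_hasDeriv_right_of_le ht.1 (f := f) (f' := h)
      (fun s hs => ((hf s (hsub hs)).continuousWithinAt).mono hsub)
      (fun s hs => by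
        have := hf s (hsub ⟨hs.1.le, hs.2.le⟩)
        refine this.mono_of_mem_nhdsWithin ?_
        exact mem_nhdsWithin_of_mem_nhds (Icc_mem_nhds hs.1 (hs.2.trans_le ht.2))) hii
    rw [← e]
    refine (intervalIntegral.abs_integral_le_integral_abs ht.1).trans ?_
    rw [intervalIntegral.integral_of_le ht.1]
    exact setIntegral_mono_set hIntg (by filter_upwards with s using abs_nonneg _)
      (Filter.Eventually.of_forall (fun s hs => hsub (Set.Ioc_subset_Icc_self hs)))
  have h2 : ∀ t ∈ Set.Icc 0 T, |v t - v 0 - t * f 0| ≤ I * t := by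
    intro t ht
    have hd : ∀ s ∈ Set.Icc 0 T, HasDerivWithinAt (fun s => v s - s * f 0) (f s - f 0)
        (Set.Icc 0 T) s := by
      intro s hs
      have := (hv s hs).sub ((hasDerivWithinAt_id s (Set.Icc 0 T)).mul_const (f 0))
      simp only [one_mul] at this
      exact this
    have := (convex_Icc (0 : ℝ) T).norm_image_sub_le_of_norm_hasDerivWithin_le (C := I) hd
      (fun s hs => h1 s hs) (x := 0) (y := t) ⟨le_rfl, hT.le⟩ ht
    simp only [Real.norm_eq_abs, sub_zero, zero_mul, abs_of_nonneg ht.1] at this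
    rw [show v t - v 0 - t * f 0 = v t - t * f 0 - v 0 by ring]
    exact this
  have hk : (0 : ℝ) < k + 1 := by positivity
  have a1 := h2 T ⟨hT.le, le_rfl⟩
  have a2 := h2 (T / (k + 1)) ⟨by positivity, div_le_self hT.le (by linarith)⟩
  have a3 : |((k : ℝ) + 1) * (v (T / (k + 1)) - v 0 - T / (k + 1) * f 0)| ≤ I * T := by
    rw [abs_mul, abs_of_pos hk]
    calc _ ≤ ((k : ℝ) + 1) * (I * (T / (k + 1))) := by gcongr
      _ = I * T := by field_simp
  have e : ((k : ℝ) + 1) * (v (T / (k + 1)) - v 0) - (v T - v 0) =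
      ((k : ℝ) + 1) * (v (T / (k + 1)) - v 0 - T / (k + 1) * f 0) - (v T - v 0 - T * f 0) := by
    field_simp; ring
  rw [e]
  refine (abs_sub _ _).trans ?_
  linarith

lemma affine_limit {T : ℝ} (hT : 0 < T) {Φ : ℝ → ℝ × ℝ → ℝ × ℝ} {L : ℝ≥0}
    {Vn : ℕ → ℝ × ℝ → ℝ × ℝ} {Φn : ℕ → ℝ → ℝ × ℝ → ℝ × ℝ}
    (hflow : ∀ n, IsFlowOn T (Vn n) (Φn n)) (hLn : ∀ n, LipschitzWith L (Vn n))
    {un fn hn : ℕ → ℝ × ℝ → ℝ} {u : ℝ × ℝ → ℝ} (hun : ∀ n, Continuous (un n))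
    (hhn : ∀ n, Continuous (hn n)) {Ω1 K1 : Set (ℝ × ℝ)} (hΩ1 : MeasurableSet Ω1)
    (hK1 : MeasurableSet K1) (hin : ∀ n, ∀ x ∈ Ω1, ∀ t ∈ Set.Icc 0 T, Φn n t x ∈ K1)
    (hv : ∀ n, ∀ x ∈ Ω1, ∀ t ∈ Set.Icc 0 T,
      HasDerivWithinAt (fun s => un n (Φn n s x)) (fn n (Φn n t x)) (Set.Icc 0 T) t)
    (hf : ∀ n, ∀ x ∈ Ω1, ∀ t ∈ Set.Icc 0 T,
      HasDerivWithinAt (fun s => fn n (Φn n s x)) (hn n (Φn n t x)) (Set.Icc 0 T) t)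
    (hlim : ∀ x ∈ Ω1, ∀ t ∈ Set.Icc 0 T,
      Tendsto (fun n => un n (Φn n t x)) atTop (𝓝 (u (Φ t x))))
    (hsmall : Tendsto (fun n => ∫⁻ x in K1, ‖hn n x‖ₑ) atTop (𝓝 0)) :
    ∀ᵐ x ∂(volume.restrict Ω1), ∀ k : ℕ,
      ((k : ℝ) + 1) * (u (Φ (T / (k + 1)) x) - u (Φ 0 x)) = u (Φ T x) - u (Φ 0 x) := by
  rw [ae_all_iff]
  intro k
  have ht1 : (0 : ℝ) ∈ Set.Icc 0 T := ⟨le_rfl, hT.le⟩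
  have ht2 : T ∈ Set.Icc 0 T := ⟨hT.le, le_rfl⟩
  have ht3 : T / ((k : ℝ) + 1) ∈ Set.Icc 0 T :=
    ⟨by positivity, div_le_self hT.le (by have : (0 : ℝ) ≤ k := Nat.cast_nonneg k; linarith)⟩
  have hcont : ∀ n, ∀ t ∈ Set.Icc 0 T, Continuous (Φn n t) := by
    intro n t ht
    have := (hflow n).jointCont (hLn n)
    exact this.comp_continuous (f := fun x => (t, x)) (by fun_prop) (fun x => ⟨ht, trivial⟩)
  set D : ℕ → ℝ × ℝ → ℝ := fun n x => ((k : ℝ) + 1) * (un n (Φn n (T / (k + 1)) x) - un n (Φn n 0 x))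
    - (un n (Φn n T x) - un n (Φn n 0 x)) with hD
  have hDm : ∀ n, Measurable (fun x => ‖D n x‖ₑ) := by
    intro n
    have c1 := (hun n).comp (hcont n _ ht1)
    have c2 := (hun n).comp (hcont n _ ht2)
    have c3 := (hun n).comp (hcont n _ ht3)
    have : Continuous (D n) := (continuous_const.mul (c3.sub c1)).sub (c2.sub c1)
    exact this.measurable.enorm
  set D0 : ℝ × ℝ → ℝ := fun x => ((k : ℝ) + 1) * (u (Φ (T / (k + 1)) x) - u (Φ 0 x))
    - (u (Φ T x) - u (Φ 0 x)) with hD0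
  have hDlim : ∀ x ∈ Ω1, Tendsto (fun n => ‖D n x‖ₑ) atTop (𝓝 ‖D0 x‖ₑ) := by
    intro x hx
    refine Tendsto.enorm ?_
    have c1 := hlim x hx _ ht1
    have c2 := hlim x hx _ ht2
    have c3 := hlim x hx _ ht3
    exact ((c3.sub c1).const_mul _).sub (c2.sub c1)
  -- the integral bound
  set A : ℝ≥0∞ := ENNReal.ofReal (2 * T) * (ENNReal.ofReal (Real.exp (L * T)) ^ (2 : ℝ) *
    ENNReal.ofReal T) with hA
  have hAtop : A ≠ ⊤ := by
    refine ENNReal.mul_ne_top ENNReal.ofReal_ne_top (ENNReal.mul_ne_top ?_ ENNReal.ofReal_ne_top)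
    exact ENNReal.rpow_ne_top_of_nonneg (by norm_num) ENNReal.ofReal_ne_top
  have hbound : ∀ n, ∫⁻ x in Ω1, ‖D n x‖ₑ ≤ A * ∫⁻ x in K1, ‖hn n x‖ₑ := by
    intro n
    set G : ℝ × ℝ → ℝ≥0∞ := K1.indicator (fun x => ‖hn n x‖ₑ) with hG
    have hGm : Measurable G := (hhn n).measurable.enorm.indicator hK1
    set Ψ : ℝ × (ℝ × ℝ) → ℝ × ℝ := fun p => Φn n (max 0 (min p.1 T)) p.2 with hΨ
    have hΨc : Continuous Ψ := by
      have := (hflow n).jointCont (hLn n)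
      exact this.comp_continuous (f := fun p : ℝ × (ℝ × ℝ) => (max 0 (min p.1 T), p.2))
        (by fun_prop) (fun p => ⟨⟨le_max_left _ _, max_le hT.le (min_le_right _ _)⟩, trivial⟩)
    have hΨe : ∀ t ∈ Set.Icc 0 T, ∀ x, Ψ (t, x) = Φn n t x := by
      intro t ht x
      simp only [hΨ]
      rw [min_eq_left ht.2, max_eq_right ht.1]
    have hpt : ∀ x ∈ Ω1, ‖D n x‖ₑ ≤ ENNReal.ofReal (2 * T) *
        ∫⁻ t in Set.Icc 0 T, G (Ψ (t, x)) := by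
      intro x hx
      have hc : ContinuousOn (fun t => hn n (Φn n t x)) (Set.Icc 0 T) :=
        (hhn n).comp_continuousOn ((hflow n).contOn x)
      have := affine_1d hT hc (hv n x hx) (hf n x hx) k
      have hIntg : IntegrableOn (fun t => hn n (Φn n t x)) (Set.Icc 0 T) :=
        hc.integrableOn_compact isCompact_Icc
      have e : ENNReal.ofReal (∫ t in Set.Icc 0 T, |hn n (Φn n t x)|) =
          ∫⁻ t in Set.Icc 0 T, G (Ψ (t, x)) := by
        have e1 := ofReal_integral_norm_eq_lintegral_enorm hIntg
        simp only [Real.norm_eq_abs] at e1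
        rw [e1]
        refine setLIntegral_congr_fun measurableSet_Icc (fun t ht => ?_)
        simp only [hG]
        rw [hΨe t ht x, Set.indicator_of_mem (hin n x hx t ht)]
      rw [← e, ← ENNReal.ofReal_mul (by positivity), Real.enorm_eq_ofReal_abs]
      exact ENNReal.ofReal_le_ofReal this
    calc ∫⁻ x in Ω1, ‖D n x‖ₑ
        ≤ ∫⁻ x in Ω1, ENNReal.ofReal (2 * T) * ∫⁻ t in Set.Icc 0 T, G (Ψ (t, x)) :=
          setLIntegral_mono' hΩ1 hpt
      _ ≤ ∫⁻ x, ENNReal.ofReal (2 * T) * ∫⁻ t in Set.Icc 0 T, G (Ψ (t, x)) :=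
          setLIntegral_le_lintegral _ _
      _ = ENNReal.ofReal (2 * T) * ∫⁻ x, ∫⁻ t in Set.Icc 0 T, G (Ψ (t, x)) := by
          rw [lintegral_const_mul' _ _ ENNReal.ofReal_ne_top]
      _ = ENNReal.ofReal (2 * T) * ∫⁻ t in Set.Icc 0 T, ∫⁻ x, G (Ψ (t, x)) := by
          congr 1
          refine lintegral_lintegral_swap ?_
          refine Measurable.aemeasurable ?_
          exact hGm.comp (hΨc.measurable.comp measurable_swap)
      _ ≤ ENNReal.ofReal (2 * T) * ∫⁻ t in Set.Icc 0 T,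
            (ENNReal.ofReal (Real.exp (L * T)) ^ (2 : ℝ) * ∫⁻ x, G x) := by
          gcongr 1
          refine setLIntegral_mono' measurableSet_Icc (fun t ht => ?_)
          simp only [hΨe t ht]
          exact (hflow n).lintegral_comp_le (hLn n) ht hGm
      _ = A * ∫⁻ x in K1, ‖hn n x‖ₑ := by
          rw [setLIntegral_const, Real.volume_Icc, sub_zero, hG, lintegral_indicator hK1, hA]
          ring
  have hz : ∫⁻ x in Ω1, ‖D0 x‖ₑ = 0 := by
    refine le_antisymm ?_ (zero_le)
    have h1 : ∫⁻ x in Ω1, ‖D0 x‖ₑ = ∫⁻ x in Ω1, liminf (fun n => ‖D n x‖ₑ) atTop :=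
      setLIntegral_congr_fun hΩ1 (fun x hx => (hDlim x hx).liminf_eq.symm)
    rw [h1]
    refine (lintegral_liminf_le hDm).trans ?_
    have h2 : Tendsto (fun n => A * ∫⁻ x in K1, ‖hn n x‖ₑ) atTop (𝓝 0) := by
      have := ENNReal.Tendsto.const_mul (a := A) hsmall (Or.inr hAtop)
      simpa using this
    have h3 : Tendsto (fun n => ∫⁻ x in Ω1, ‖D n x‖ₑ) atTop (𝓝 0) :=
      tendsto_of_tendsto_of_tendsto_of_le_of_le tendsto_const_nhds h2 (fun n => zero_le) hbound
    exact h3.liminf_eq.le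
  have hae : AEMeasurable (fun x => ‖D0 x‖ₑ) (volume.restrict Ω1) := by
    refine aemeasurable_of_tendsto_metrizable_ae atTop (fun n => (hDm n).aemeasurable) ?_
    exact (ae_restrict_iff' hΩ1).2 (Filter.Eventually.of_forall hDlim)
  have := (lintegral_eq_zero_iff' hae).1 hz
  filter_upwards [this] with x hx
  have : D0 x = 0 := by simpa using hx
  exact sub_eq_zero.1 this

lemma lip_ibp {w : ℝ × ℝ → ℝ} {C : ℝ≥0} (hw : LipschitzWith C w) {Ω1 : Set (ℝ × ℝ)}
    (v : ℝ × ℝ) {F : ℝ × ℝ → ℝ}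
    (hF : ∀ᵐ x ∂(volume.restrict Ω1), F x = w x) {φ : ℝ × ℝ → ℝ} (hφ : IsTest Ω1 φ) :
    (∫ x in Ω1, F x * fderiv ℝ φ x v) = -∫ x in Ω1, lineDeriv ℝ w x v * φ x := by
  obtain ⟨hs, hc, hsub⟩ := hφ
  obtain ⟨D, hD⟩ := hs.lipschitzWith_of_hasCompactSupport hc (by simp)
  have h1 : (∫ x in Ω1, F x * fderiv ℝ φ x v) = ∫ x in Ω1, w x * fderiv ℝ φ x v := by
    refine integral_congr_ae ?_
    filter_upwards [hF] with x hx
    rw [hx]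
  rw [h1, setIntegral_eq_integral_of_forall_compl_eq_zero,
    setIntegral_eq_integral_of_forall_compl_eq_zero]
  · have := hw.integral_lineDeriv_mul_eq (μ := volume) hD hc v
    rw [this, ← integral_neg]
    refine integral_congr_ae (Filter.Eventually.of_forall fun x => ?_)
    simp only
    rw [(sm_diff hs x).lineDeriv_eq_fderiv]
    simp [mul_comm]
  · intro x hx
    rw [image_eq_zero_of_notMem_tsupport (fun h => hx (hsub h)), mul_zero]
  · intro x hx
    rw [fderiv_of_notMem_tsupport ℝ (fun h => hx (hsub h))]
    simp

lemma concl {w : ℝ × ℝ → ℝ} {C : ℝ≥0} (hw : LipschitzWith C w) {Ω1 : Set (ℝ × ℝ)}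
    (hc : IsCompact (closure Ω1)) {F : ℝ × ℝ → ℝ}
    (hF : ∀ᵐ x ∂(volume.restrict Ω1), F x = w x) {p : ℝ} (hp : 1 < p) :
    ∃ g1 g2 : ℝ × ℝ → ℝ,
        IntegrableOn (fun x => |F x| ^ p) Ω1 ∧
        IntegrableOn (fun x => |g1 x| ^ p) Ω1 ∧
        IntegrableOn (fun x => |g2 x| ^ p) Ω1 ∧
        (∀ φ : ℝ × ℝ → ℝ, IsTest Ω1 φ →
          (∫ x in Ω1, F x * pd1 φ x) = -∫ x in Ω1, g1 x * φ x) ∧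
        (∀ φ : ℝ × ℝ → ℝ, IsTest Ω1 φ →
          (∫ x in Ω1, F x * pd2 φ x) = -∫ x in Ω1, g2 x * φ x) := by
  have hfin : volume Ω1 ≠ ⊤ := ((measure_mono subset_closure).trans_lt hc.measure_lt_top).ne
  have hp0 : 0 ≤ p := by linarith
  have hg : ∀ v : ℝ × ℝ, IntegrableOn (fun x => |lineDeriv ℝ w x v| ^ p) Ω1 := by
    intro v
    refine Measure.integrableOn_of_bounded (M := (C * ‖v‖) ^ p) hfin ?_ ?_
    · exact ((measurable_lineDeriv hw.continuous).norm.pow_const p).aestronglyMeasurable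
    · filter_upwards with x
      rw [Real.norm_of_nonneg (by positivity)]
      exact Real.rpow_le_rpow (abs_nonneg _) (norm_lineDeriv_le_of_lipschitz ℝ hw) hp0
  refine ⟨fun x => lineDeriv ℝ w x (1, 0), fun x => lineDeriv ℝ w x (0, 1), ?_, hg _, hg _,
    fun φ hφ => lip_ibp hw (1, 0) hF hφ, fun φ hφ => lip_ibp hw (0, 1) hF hφ⟩
  have h1 : IntegrableOn (fun x => |w x| ^ p) Ω1 := by
    have : Continuous (fun x => |w x| ^ p) :=
      hw.continuous.abs.rpow_const (fun x => Or.inr hp0)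
    exact (this.continuousOn.integrableOn_compact hc).mono_set subset_closure
  refine h1.congr ?_
  filter_upwards [hF] with x hx
  rw [hx]

lemma exists_cutoff {Ω K1 : Set (ℝ × ℝ)} (hΩo : IsOpen Ω) (hK : IsCompact K1) (hKΩ : K1 ⊆ Ω) :
    ∃ φ : ℝ × ℝ → ℝ, ContDiff ℝ (⊤ : ℕ∞) φ ∧ HasCompactSupport φ ∧ tsupport φ ⊆ Ω ∧
      (∀ p, |φ p| ≤ 1) ∧ ∀ p ∈ K1, φ p = 1 := by
  obtain ⟨δ, hδ, hsub⟩ := hK.exists_cthickening_subset_open hΩo hKΩ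
  obtain ⟨f, h0, h1, hf⟩ := exists_contMDiffMap_zero_one_of_isClosed
    (modelWithCornersSelf ℝ (ℝ × ℝ)) (n := (⊤ : ℕ∞)) (s := (Metric.thickening δ K1)ᶜ) (t := K1)
    Metric.isOpen_thickening.isClosed_compl hK.isClosed
    (Set.disjoint_left.2 fun x hx hxK => hx (Metric.self_subset_thickening hδ K1 hxK))
  have hts : tsupport f ⊆ Metric.cthickening δ K1 := by
    refine closure_minimal ?_ Metric.isClosed_cthickening
    intro x hx
    by_contra hne
    refine hx (h0 (fun h => hne (Metric.thickening_subset_cthickening _ _ h)))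
  refine ⟨f, f.contMDiff.contDiff, ?_, hts.trans hsub, fun p => ?_, fun p hp => h1 hp⟩
  · exact hK.cthickening.of_isClosed_subset (isClosed_tsupport _) hts
  · rw [abs_of_nonneg (hf p).1]; exact (hf p).2

/-- Cut off coefficient. -/
lemma cut_coeff {φ : ℝ × ℝ → ℝ} (hφ : ContDiff ℝ (⊤ : ℕ∞) φ) (hφc : HasCompactSupport φ) {l : ℝ≥0}
    {s : ℝ × ℝ × ℝ → ℝ} (hs : ContDiff ℝ (⊤ : ℕ∞) s) :
    ∃ (S : ℝ × ℝ × ℝ → ℝ) (L M : ℝ≥0), LipschitzWith L S ∧ (∀ q, |S q| ≤ M) ∧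
      (∀ q, (q.1, q.2.1) ∉ tsupport φ → S q = 0) ∧
      (∀ q, φ (q.1, q.2.1) = 1 → |q.2.2| ≤ (l : ℝ) → S q = s q) := by
  have hl : (0 : ℝ) ≤ l := l.2
  let η : ContDiffBump (0 : ℝ) := ⟨l + 1, l + 2, by linarith, by linarith⟩
  set S : ℝ × ℝ × ℝ → ℝ := fun q => φ (q.1, q.2.1) * η q.2.2 * s q with hS
  have hsm : ContDiff ℝ (⊤ : ℕ∞) S := by
    have h1 : ContDiff ℝ (⊤ : ℕ∞) (fun q : ℝ × ℝ × ℝ => φ (q.1, q.2.1)) :=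
      hφ.comp (contDiff_fst.prodMk (contDiff_fst.comp contDiff_snd))
    have h2 : ContDiff ℝ (⊤ : ℕ∞) (fun q : ℝ × ℝ × ℝ => η q.2.2) :=
      η.contDiff.comp (contDiff_snd.comp contDiff_snd)
    exact (h1.mul h2).mul hs
  have hcs : HasCompactSupport S := by
    have hι : Continuous (fun r : (ℝ × ℝ) × ℝ => (r.1.1, r.1.2, r.2)) := by fun_prop
    have hcomp : IsCompact ((fun r : (ℝ × ℝ) × ℝ => (r.1.1, r.1.2, r.2)) ''
        (tsupport φ ×ˢ tsupport η)) :=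
      (IsCompact.prod hφc η.hasCompactSupport).image hι
    refine HasCompactSupport.intro hcomp ?_
    intro q hq
    by_contra hne
    refine hq ⟨((q.1, q.2.1), q.2.2), ⟨?_, ?_⟩, rfl⟩
    · by_contra h
      exact hne (by simp only [hS]; rw [image_eq_zero_of_notMem_tsupport h]; simp)
    · by_contra h
      exact hne (by simp only [hS]; rw [image_eq_zero_of_notMem_tsupport h]; simp)
  obtain ⟨L, hL⟩ := hsm.lipschitzWith_of_hasCompactSupport hcs (by simp)
  obtain ⟨B, hB⟩ := hcs.exists_bound_of_continuous hsm.continuous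
  refine ⟨S, L, B.toNNReal, hL, fun q => (hB q).trans (Real.le_coe_toNNReal B), ?_, ?_⟩
  · intro q hq
    simp only [hS]
    rw [image_eq_zero_of_notMem_tsupport hq]; simp
  · intro q h1 h2
    simp only [hS]
    rw [h1, η.one_of_mem_closedBall, one_mul, one_mul]
    simp only [Metric.mem_closedBall, dist_zero_right, Real.norm_eq_abs]
    show |q.2.2| ≤ (l : ℝ) + 1
    linarith

lemma field_lip {S1 S2 : ℝ × ℝ × ℝ → ℝ} {L1 L2 c : ℝ≥0} (h1 : LipschitzWith L1 S1)
    (h2 : LipschitzWith L2 S2) {U : ℝ × ℝ → ℝ} (hU : LipschitzWith c U) :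
    LipschitzWith (max (L1 * max 1 (max 1 c)) (L2 * max 1 (max 1 c)))
      (fun x : ℝ × ℝ => (S1 (x.1, x.2, U x), S2 (x.1, x.2, U x))) := by
  have hg : LipschitzWith (max 1 (max 1 c)) (fun x : ℝ × ℝ => (x.1, x.2, U x)) :=
    LipschitzWith.prod_fst.prodMk (LipschitzWith.prod_snd.prodMk hU)
  exact (h1.comp hg).prodMk (h2.comp hg)

lemma exists_sup_seq {Vn : ℕ → ℝ × ℝ → ℝ × ℝ} {V : ℝ × ℝ → ℝ × ℝ} {M : ℝ}
    (hn : ∀ n x, ‖Vn n x‖ ≤ M) (hV : ∀ x, ‖V x‖ ≤ M)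
    (h : ∀ e > 0, ∀ᶠ n in atTop, ∀ x, dist (Vn n x) (V x) ≤ e) :
    ∃ δ : ℕ → ℝ, Tendsto δ atTop (𝓝 0) ∧ ∀ n x, dist (Vn n x) (V x) ≤ δ n := by
  have hb : ∀ n, BddAbove (Set.range fun x => dist (Vn n x) (V x)) := by
    intro n
    refine ⟨M + M, ?_⟩
    rintro _ ⟨x, rfl⟩
    exact (dist_le_norm_add_norm _ _).trans (add_le_add (hn n x) (hV x))
  refine ⟨fun n => ⨆ x, dist (Vn n x) (V x), ?_, fun n x => le_ciSup (hb n) x⟩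
  rw [Metric.tendsto_atTop]
  intro e he
  obtain ⟨N, hN⟩ := eventually_atTop.1 (h (e / 2) (half_pos he))
  refine ⟨N, fun n hn => ?_⟩
  have h1 : (⨆ x, dist (Vn n x) (V x)) ≤ e / 2 := ciSup_le (hN n hn)
  have h2 : 0 ≤ ⨆ x, dist (Vn n x) (V x) := Real.iSup_nonneg fun x => dist_nonneg
  rw [Real.dist_eq, sub_zero, abs_of_nonneg h2]
  linarith

lemma fderiv_pair (F : ℝ × ℝ → ℝ) (p : ℝ × ℝ) (a b : ℝ) :
    fderiv ℝ F p (a, b) = a * pd1 F p + b * pd2 F p := by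
  have : (a, b) = a • ((1 : ℝ), (0 : ℝ)) + b • ((0 : ℝ), (1 : ℝ)) := by simp
  rw [this, map_add, map_smul, map_smul]
  rfl

lemma l1_small {K1 : Set (ℝ × ℝ)} (hK1 : IsCompact K1) {φ : ℝ × ℝ → ℝ}
    (hφ : Continuous φ) (hφc : HasCompactSupport φ) (hφ1 : ∀ p ∈ K1, φ p = 1)
    {h : ℝ × ℝ → ℝ} (hh : Continuous h) {C ε : ℝ} (hε : 0 < ε)
    (hb : ∫ p, φ p ^ 2 * h p ^ 2 ≤ C * ε ^ 2) :
    ∫⁻ x in K1, ‖h x‖ₑ ≤ ENNReal.ofReal (((volume K1).toReal + C) * ε) := by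
  have hIntg : IntegrableOn h K1 := hh.continuousOn.integrableOn_compact hK1
  rw [← ofReal_integral_norm_eq_lintegral_enorm hIntg]
  refine ENNReal.ofReal_le_ofReal ?_
  have hi2 : Integrable (fun p => φ p ^ 2 * h p ^ 2) := by
    refine Continuous.integrable_of_hasCompactSupport (by fun_prop) ?_
    refine hφc.mono ?_
    intro x hx hx0
    exact hx (by simp [hx0])
  have hconst : IntegrableOn (fun _ : ℝ × ℝ => ε) K1 :=
    continuous_const.continuousOn.integrableOn_compact hK1
  have h1 : ∫ x in K1, ‖h x‖ ≤ ∫ x in K1, (ε + φ x ^ 2 * h x ^ 2 / ε) := by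
    refine setIntegral_mono_on hIntg.norm (hconst.add (hi2.integrableOn.div_const ε))
      hK1.measurableSet ?_
    intro x hx
    rw [hφ1 x hx, Real.norm_eq_abs]
    have h2 : |h x| * ε ≤ ε * ε + 1 ^ 2 * h x ^ 2 := by
      rw [← sq_abs (h x)]
      nlinarith [sq_nonneg (|h x| - ε), abs_nonneg (h x)]
    have : ε + 1 ^ 2 * h x ^ 2 / ε = (ε * ε + 1 ^ 2 * h x ^ 2) / ε := by field_simp
    rw [this, le_div_iff₀ hε]
    exact h2
  refine h1.trans ?_
  rw [integral_add hconst (hi2.integrableOn.div_const ε), setIntegral_const, integral_div]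
  have h3 : ∫ x in K1, φ x ^ 2 * h x ^ 2 ≤ C * ε ^ 2 :=
    (setIntegral_le_integral hi2 (Filter.Eventually.of_forall fun x => by positivity)).trans hb
  have h4 : (∫ x in K1, φ x ^ 2 * h x ^ 2) / ε ≤ C * ε := by
    rw [div_le_iff₀ hε]; linarith [h3]
  simp only [smul_eq_mul, Measure.real]
  linarith

lemma slope_const {T D w : ℝ} (hT : 0 < T) {F : ℝ → ℝ}
    (hF : HasDerivWithinAt F D (Set.Icc 0 T) 0)
    (hk : ∀ k : ℕ, ((k : ℝ) + 1) * (F (T / (k + 1)) - F 0) = w) : D = w / T := by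
  have h1 := hasDerivWithinAt_iff_tendsto_slope.1 hF
  have h2 : Tendsto (fun k : ℕ => T / ((k : ℝ) + 1)) atTop (𝓝[Set.Icc 0 T \ {0}] 0) := by
    rw [tendsto_nhdsWithin_iff]
    constructor
    · have := (tendsto_one_div_add_atTop_nhds_zero_nat (𝕜 := ℝ)).const_mul T
      simpa [div_eq_mul_inv] using this
    · refine Filter.Eventually.of_forall fun k => ?_
      have hk0 : (0 : ℝ) ≤ k := Nat.cast_nonneg k
      refine ⟨⟨by positivity, div_le_self hT.le (by linarith)⟩, ?_⟩
      simp only [Set.mem_singleton_iff]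
      positivity
  have h3 := h1.comp h2
  have h4 : (slope F 0 ∘ fun k : ℕ => T / ((k : ℝ) + 1)) = fun _ => w / T := by
    funext k
    simp only [Function.comp, slope, vsub_eq_sub, sub_zero, smul_eq_mul]
    rw [← hk k]
    have : (k : ℝ) + 1 ≠ 0 := by positivity
    field_simp
  rw [h4] at h3
  exact tendsto_nhds_unique h3 tendsto_const_nhds

theorem stmt_18
    (Ω : Set (ℝ × ℝ)) (hΩo : IsOpen Ω) (hΩb : Bornology.IsBounded Ω)
    (s11 s12 : ℝ × ℝ × ℝ → ℝ) (hs11 : ContDiff ℝ (⊤ : ℕ∞) s11) (hs12 : ContDiff ℝ (⊤ : ℕ∞) s12)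
    (hrank : RankCond s11 s12)
    (u : ℝ × ℝ → ℝ) (lu : NNReal) (hulip : LipschitzOnWith lu u Ω)
    (huvv : IsVVSol s11 s12 Ω u) :
    ∀ p : ℝ, 1 < p →
    ∀ Ω1 : Set (ℝ × ℝ), IsOpen Ω1 → IsCompact (closure Ω1) → closure Ω1 ⊆ Ω →
      ∃ g1 g2 : ℝ × ℝ → ℝ,
        IntegrableOn (fun x => |X1 s11 s12 u u x| ^ p) Ω1 ∧
        IntegrableOn (fun x => |g1 x| ^ p) Ω1 ∧
        IntegrableOn (fun x => |g2 x| ^ p) Ω1 ∧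
        (∀ φ : ℝ × ℝ → ℝ, IsTest Ω1 φ →
          (∫ x in Ω1, X1 s11 s12 u u x * pd1 φ x) = -∫ x in Ω1, g1 x * φ x) ∧
        (∀ φ : ℝ × ℝ → ℝ, IsTest Ω1 φ →
          (∫ x in Ω1, X1 s11 s12 u u x * pd2 φ x) = -∫ x in Ω1, g2 x * φ x) := by
  intro p hp Ω1 hΩ1o hΩ1c hΩ1Ω
  obtain ⟨εs, us, l, hε, hεlim, hus, hL, hlip, hbd, hunif⟩ := huvv
  -- pointwise limit and bound of the limit
  have hptlim : ∀ x ∈ Ω, Tendsto (fun n => us n x) atTop (𝓝 (u x)) := fun x hx =>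
    (hunif {x} (by simpa using hx) isCompact_singleton).tendsto_at rfl
  have hubd : ∀ x ∈ Ω, |u x| ≤ (l : ℝ) := fun x hx =>
    le_of_tendsto (hptlim x hx).abs (Filter.Eventually.of_forall fun n => hbd n x hx)
  -- neighbourhood, cutoff, coefficients
  obtain ⟨δ, hδ, hK1Ω⟩ := hΩ1c.exists_cthickening_subset_open hΩo hΩ1Ω
  set K1 := Metric.cthickening δ (closure Ω1) with hK1def
  have hK1 : IsCompact K1 := hΩ1c.cthickening
  obtain ⟨φ, hφ, hφc, hφΩ, hφ1, hφK⟩ := exists_cutoff hΩo hK1 hK1Ω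
  obtain ⟨S1, L1, M1, hL1, hM1, hS1z, hS1⟩ := cut_coeff hφ hφc (l := l) hs11
  obtain ⟨S2, L2, M2, hL2, hM2, hS2z, hS2⟩ := cut_coeff hφ hφc (l := l) hs12
  obtain ⟨U, hUl, hUe⟩ := hulip.extend_real
  have hex : ∀ n, ∃ g : ℝ × ℝ → ℝ, LipschitzWith l g ∧ Set.EqOn (us n) g Ω :=
    fun n => (hlip n).extend_real
  choose Un hUnl hUne using hex
  set Vn : ℕ → ℝ × ℝ → ℝ × ℝ := fun n x => (S1 (x.1, x.2, Un n x), S2 (x.1, x.2, Un n x)) with hVn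
  set V : ℝ × ℝ → ℝ × ℝ := fun x => (S1 (x.1, x.2, U x), S2 (x.1, x.2, U x)) with hV
  have hVnL : ∀ n, LipschitzWith (max (L1 * max 1 (max 1 l)) (L2 * max 1 (max 1 l))) (Vn n) :=
    fun n => field_lip hL1 hL2 (hUnl n)
  have hVL : LipschitzWith (max (L1 * max 1 (max 1 lu)) (L2 * max 1 (max 1 lu))) V :=
    field_lip hL1 hL2 hUl
  set M : ℝ≥0 := max M1 M2 with hMdef
  have hpair : ∀ q : ℝ × ℝ × ℝ, ‖(S1 q, S2 q)‖ ≤ (M : ℝ) := by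
    intro q
    refine norm_prod_le_iff.2 ⟨(hM1 q).trans ?_, (hM2 q).trans ?_⟩
    · exact_mod_cast le_max_left M1 M2
    · exact_mod_cast le_max_right M1 M2
  have hVnM : ∀ n x, ‖Vn n x‖ ≤ (M : ℝ) := fun n x => hpair _
  have hVM : ∀ x, ‖V x‖ ≤ (M : ℝ) := fun x => hpair _
  -- the flows
  set T : ℝ := δ / (M + 1) with hTdef
  have hM0 : (0 : ℝ) ≤ M := M.2
  have hT : 0 < T := by positivity
  have hMT : (M : ℝ) * T ≤ δ := by
    rw [hTdef, mul_div_assoc', div_le_iff₀ (by positivity)]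
    nlinarith
  obtain ⟨Φ, hΦ⟩ := flow_exists hT hVL hVM
  have hexn : ∀ n, ∃ Ψ, IsFlowOn T (Vn n) Ψ := fun n => flow_exists hT (hVnL n) (hVnM n)
  choose Φn hΦn using hexn
  have hstay : ∀ x ∈ Ω1, ∀ t ∈ Set.Icc 0 T, ∀ y, dist y x ≤ M * t → y ∈ K1 := by
    intro x hx t ht y hy
    refine Metric.mem_cthickening_of_dist_le y x δ _ (subset_closure hx) (hy.trans ?_)
    exact (mul_le_mul_of_nonneg_left ht.2 hM0).trans hMT
  have hin : ∀ x ∈ Ω1, ∀ t ∈ Set.Icc 0 T, Φ t x ∈ K1 := fun x hx t ht =>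
    hstay x hx t ht _ (hΦ.dist_self_le hVM x ht)
  have hinn : ∀ n, ∀ x ∈ Ω1, ∀ t ∈ Set.Icc 0 T, Φn n t x ∈ K1 := fun n x hx t ht =>
    hstay x hx t ht _ ((hΦn n).dist_self_le (hVnM n) x ht)
  -- values of the fields on `K1`
  have hVnK : ∀ n, ∀ y ∈ K1, Vn n y = (s11 (y.1, y.2, us n y), s12 (y.1, y.2, us n y)) := by
    intro n y hy
    have hyΩ := hK1Ω hy
    simp only [hVn]
    rw [← hUne n hyΩ, hS1 _ (hφK y hy) (hbd n y hyΩ), hS2 _ (hφK y hy) (hbd n y hyΩ)]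
  have hVK : ∀ y ∈ K1, V y = (s11 (y.1, y.2, u y), s12 (y.1, y.2, u y)) := by
    intro y hy
    have hyΩ := hK1Ω hy
    simp only [hV]
    rw [← hUe hyΩ, hS1 _ (hφK y hy) (hubd y hyΩ), hS2 _ (hφK y hy) (hubd y hyΩ)]
  -- uniform convergence of the fields
  have hVconv : ∀ e > 0, ∀ᶠ n in atTop, ∀ x, dist (Vn n x) (V x) ≤ e := by
    intro e he
    have hLL : (0 : ℝ) < L1 + L2 + 1 := by positivity
    have := Metric.tendstoUniformlyOn_iff.1 (hunif (tsupport φ) hφΩ hφc) (e / (L1 + L2 + 1))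
      (by positivity)
    filter_upwards [this] with n hn x
    by_cases hx : x ∈ tsupport φ
    · have h1 := hn x hx
      have hq : dist (x.1, x.2, Un n x) (x.1, x.2, U x) ≤ e / (L1 + L2 + 1) := by
        rw [← hUne n (hφΩ hx), ← hUe (hφΩ hx)]
        simp only [Prod.dist_eq, dist_self]
        rw [max_eq_right (by positivity), max_eq_right (by positivity), dist_comm]
        exact h1.le
      have hmul : ∀ c : ℝ≥0, (c : ℝ) ≤ L1 + L2 + 1 →
          (c : ℝ) * dist (x.1, x.2, Un n x) (x.1, x.2, U x) ≤ e := by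
        intro c hc
        calc _ ≤ ((L1 : ℝ) + L2 + 1) * (e / (L1 + L2 + 1)) :=
              mul_le_mul hc hq dist_nonneg hLL.le
          _ = e := by field_simp
      have l1 : (0 : ℝ) ≤ L1 := L1.2
      have l2 : (0 : ℝ) ≤ L2 := L2.2
      rw [Prod.dist_eq]
      refine max_le ((hL1.dist_le_mul _ _).trans (hmul L1 (by linarith)))
        ((hL2.dist_le_mul _ _).trans (hmul L2 (by linarith)))
    · simp only [hVn, hV]
      rw [hS1z _ hx, hS2z _ hx, hS1z _ hx, hS2z _ hx, dist_self]
      exact he.le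
  obtain ⟨dn, hdn, hdn'⟩ := exists_sup_seq hVnM hVM hVconv
  have hΦlim : ∀ x, ∀ t ∈ Set.Icc 0 T, Tendsto (fun n => Φn n t x) atTop (𝓝 (Φ t x)) :=
    fun x t ht => hΦ.tendsto_of hVL hΦn hdn hdn' x ht
  -- the smooth functions
  have hfsm : ∀ n, ContDiff ℝ (⊤ : ℕ∞) (X1 s11 s12 (us n) (us n)) := fun n =>
    ((graph_smooth hs11 (hus n)).mul (pd1_smooth (hus n))).add
      ((graph_smooth hs12 (hus n)).mul (pd2_smooth (hus n)))
  have hhsm : ∀ n, ContDiff ℝ (⊤ : ℕ∞) (X1 s11 s12 (us n) (X1 s11 s12 (us n) (us n))) := fun n =>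
    ((graph_smooth hs11 (hus n)).mul (pd1_smooth (hfsm n))).add
      ((graph_smooth hs12 (hus n)).mul (pd2_smooth (hfsm n)))
  have hchain : ∀ n (F : ℝ × ℝ → ℝ), Differentiable ℝ F → ∀ x ∈ Ω1, ∀ t ∈ Set.Icc 0 T,
      HasDerivWithinAt (fun s => F (Φn n s x)) (X1 s11 s12 (us n) F (Φn n t x))
        (Set.Icc 0 T) t := by
    intro n F hF x hx t ht
    have h1 := (hF (Φn n t x)).hasFDerivAt.comp_hasDerivWithinAt t ((hΦn n x).2 t ht)
    rw [hVnK n _ (hinn n x hx t ht), fderiv_pair] at h1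
    exact h1
  -- energy estimate
  obtain ⟨C, hC0, hC⟩ := hess_small hΩo l hs11 hs12 hrank hφ hφc hφΩ hφ1
  have hsmall : Tendsto (fun n => ∫⁻ x in K1,
      ‖X1 s11 s12 (us n) (X1 s11 s12 (us n) (us n)) x‖ₑ) atTop (𝓝 0) := by
    have hub : ∀ n, ∫⁻ x in K1, ‖X1 s11 s12 (us n) (X1 s11 s12 (us n) (us n)) x‖ₑ ≤
        ENNReal.ofReal (((volume K1).toReal + C) * εs n) := fun n =>
      l1_small hK1 hφ.continuous hφc hφK (hhsm n).continuous (hε n).1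
        (hC (us n) (εs n) (hε n).1 (hε n).2 (hus n) (hlip n) (hbd n) (hL n))
    have h2 : Tendsto (fun n => ENNReal.ofReal (((volume K1).toReal + C) * εs n)) atTop (𝓝 0) := by
      have := ENNReal.tendsto_ofReal (hεlim.const_mul ((volume K1).toReal + C))
      simpa using this
    exact tendsto_of_tendsto_of_tendsto_of_le_of_le tendsto_const_nhds h2 (fun n => zero_le) hub
  have hulim : ∀ x ∈ Ω1, ∀ t ∈ Set.Icc 0 T,
      Tendsto (fun n => us n (Φn n t x)) atTop (𝓝 (U (Φ t x))) := by
    intro x hx t ht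
    rw [← hUe (hK1Ω (hin x hx t ht))]
    refine (hunif K1 hK1Ω hK1).tendsto_comp ?_ ?_
    · exact (hulip.continuousOn.mono hK1Ω) _ (hin x hx t ht)
    · exact tendsto_nhdsWithin_iff.2 ⟨hΦlim x t ht,
        Filter.Eventually.of_forall fun n => hinn n x hx t ht⟩
  have haff := affine_limit hT hΦn hVnL (fun n => (hus n).continuous)
    (fun n => (hhsm n).continuous) hΩ1o.measurableSet hK1.measurableSet hinn
    (fun n => hchain n _ (sm_diff (hus n))) (fun n => hchain n _ (sm_diff (hfsm n))) hulim hsmall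
  -- the Lipschitz representative
  have hTmem : T ∈ Set.Icc 0 T := ⟨hT.le, le_rfl⟩
  have hΦTL : LipschitzWith
      (Real.exp ((max (L1 * max 1 (max 1 lu)) (L2 * max 1 (max 1 lu)) : ℝ≥0) * T)).toNNReal
      (Φ T) := by
    refine LipschitzWith.of_dist_le_mul fun x y => ?_
    rw [Real.coe_toNNReal _ (Real.exp_pos _).le]
    exact hΦ.dist_le hVL x y hTmem
  have hw : LipschitzWith _ (fun x => T⁻¹ • (U (Φ T x) - U x)) :=
    (lipschitzWith_smul (T⁻¹ : ℝ)).comp ((hUl.comp hΦTL).sub hUl)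
  refine concl hw hΩ1c ?_ hp
  have hrad : ∀ᵐ x ∂(volume.restrict Ω1), DifferentiableAt ℝ U x :=
    ae_restrict_of_ae hUl.ae_differentiableAt
  filter_upwards [haff, hrad, ae_restrict_mem hΩ1o.measurableSet] with x hx hdx hxΩ1
  have h0mem : (0 : ℝ) ∈ Set.Icc 0 T := ⟨le_rfl, hT.le⟩
  have hxK : x ∈ K1 := by
    have := hin x hxΩ1 0 h0mem
    rwa [(hΦ x).1] at this
  have hder : HasDerivWithinAt (fun s => U (Φ s x)) (X1 s11 s12 u u x) (Set.Icc 0 T) 0 := by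
    have hd0 : HasFDerivAt U (fderiv ℝ U x) (Φ 0 x) := by
      rw [(hΦ x).1]; exact hdx.hasFDerivAt
    have h1 := hd0.comp_hasDerivWithinAt 0 ((hΦ x).2 0 h0mem)
    have heq : U =ᶠ[𝓝 x] u := by
      filter_upwards [hΩo.mem_nhds (hK1Ω hxK)] with y hy
      exact (hUe hy).symm
    rw [(hΦ x).1, hVK x hxK, heq.fderiv_eq, fderiv_pair] at h1
    exact h1
  have := slope_const hT hder hx
  rw [this, (hΦ x).1, smul_eq_mul, div_eq_inv_mul]

end
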